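/- arXiv:1909.07253 — 4 statements merged into one kernel-verified Lean document; each statement's English description precedes it below -/
import Mathlib

section
/- Let R be a Noetherian commutative ring and A ⊆ R a subring which is a Noetherian integral domain, with field of fractions Quot(A). Let p be a prime ideal of R with p ∩ A = 0, and write k(p) = R_p/pR_p, regarded as an R-module via the canonical maps R → R_p → k(p). Suppose the ring k(p) ⊗_{Quot(A)} R_p is Noetherian. Then for every p-primary ideal I of R there exists an (R ⊗_A R)-submodule E ⊆ Diff_{R/A}(R, k(p)) such that I = Sol(E), and E is finitely generated as an R_p-module via the left (post-composition) module structure. -/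
set_option linter.unusedSectionVars false

open scoped TensorProduct

namespace NoetherianOps

universe u v

section DiffOps

variable (A R M N : Type*) [CommRing A] [CommRing R] [Algebra A R]
  [AddCommGroup M] [Module A M] [Module R M] [IsScalarTower A R M]
  [AddCommGroup N] [Module A N] [Module R N] [IsScalarTower A R N]

/-- Pre-composition of an `A`-linear map `δ : M →ₗ[A] N` with scalar multiplication by `r : R`,
i.e. the map `m ↦ δ (r • m)`. -/
def preSMul (r : R) (δ : M →ₗ[A] N) : M →ₗ[A] N :=
  δ.comp (r • (LinearMap.id : M →ₗ[A] M))

@[simp] lemma preSMul_apply (r : R) (δ : M →ₗ[A] N) (m : M) :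
    preSMul A R M N r δ m = δ (r • m) := rfl

/-- The bracket `[δ, r] : m ↦ δ (r • m) - r • δ m` of an `A`-linear map `δ : M →ₗ[A] N`
with multiplication by `r : R`. -/
def opBracket (r : R) (δ : M →ₗ[A] N) : M →ₗ[A] N :=
  preSMul A R M N r δ - r • δ

@[simp] lemma opBracket_apply (r : R) (δ : M →ₗ[A] N) (m : M) :
    opBracket A R M N r δ m = δ (r • m) - r • δ m := rfl

/-- `DiffLE A R M N n` is the set of `A`-linear differential operators `M → N` of order
at most `n`: an operator has order `≤ 0` iff all brackets `[δ, r]` vanish (i.e. `δ` is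
`R`-linear), and order `≤ n + 1` iff all brackets `[δ, r]` have order `≤ n`.  This matches
the inductive definition `Diff⁻¹ = 0`, `Diffⁿ = {δ ∣ [δ, r] ∈ Diffⁿ⁻¹ for all r ∈ R}`. -/
def DiffLE : ℕ → Set (M →ₗ[A] N)
  | 0 => {δ | ∀ r : R, opBracket A R M N r δ = 0}
  | n + 1 => {δ | ∀ r : R, opBracket A R M N r δ ∈ DiffLE n}

/-- `Diff A R M N` is the set of all `A`-linear differential operators from `M` to `N`,
i.e. the union of the `DiffLE A R M N n` over all `n`. -/
def Diff : Set (M →ₗ[A] N) := {δ | ∃ n : ℕ, δ ∈ DiffLE A R M N n}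

/-- A subset `E ⊆ Hom_A(M, N)` is an `(R ⊗[A] R)`-submodule iff it is an additive subgroup
closed under the two `R`-actions `δ ↦ r • δ` (post-composition, the action of `r ⊗ 1`) and
`δ ↦ δ ∘ (r • ·)` (pre-composition, the action of `1 ⊗ r`); simple tensors generate
`R ⊗[A] R`, so this is exactly the condition of being an `(R ⊗[A] R)`-submodule for the
module structure `((r ⊗ s) • δ) (m) = r • δ (s • m)`. -/
def IsTensorSubmodule (E : Set (M →ₗ[A] N)) : Prop :=
  (0 : M →ₗ[A] N) ∈ E ∧
  (∀ δ ∈ E, ∀ ε ∈ E, δ + ε ∈ E) ∧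
  (∀ δ ∈ E, -δ ∈ E) ∧
  (∀ (r : R), ∀ δ ∈ E, r • δ ∈ E) ∧
  (∀ (r : R), ∀ δ ∈ E, preSMul A R M N r δ ∈ E)

end DiffOps

/-- The solution set of a family `E` of operators `M → N`: the set of `m ∈ M` killed by
every member of `E`. -/
def Sol {A M N : Type*} [CommRing A] [AddCommGroup M] [Module A M]
    [AddCommGroup N] [Module A N] (E : Set (M →ₗ[A] N)) : Set M :=
  {m | ∀ δ ∈ E, δ m = 0}

/-- `E` is finitely generated via the left (post-composition) `R'`-module structure on
`Hom_A(M, N)`: there is a finite subset of `E` such that every element of `E` is an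
`R'`-linear combination (for the action `(r • δ) m = r • δ m`) of its members. -/
def IsFGLeft {A M N : Type*} (R' : Type*) [CommRing A] [CommRing R']
    [AddCommGroup M] [Module A M] [AddCommGroup N] [Module A N]
    [Module R' N] [SMulCommClass A R' N] (E : Set (M →ₗ[A] N)) : Prop :=
  ∃ s : Finset (M →ₗ[A] N), ↑s ⊆ E ∧
    ∀ δ ∈ E, ∃ c : (M →ₗ[A] N) → R', δ = ∑ g ∈ s, c g • g

/-- A field extension `L/K` is separable (in the general, not necessarily algebraic, sense)
if `L ⊗[K] K'` is reduced for every field extension `K'/K` (MacLane's criterion). -/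
def IsSeparableFieldExtension (K : Type u) (L : Type v) [Field K] [Field L] [Algebra K L] :
    Prop :=
  ∀ (K' : Type u) [Field K'] [Algebra K K'], IsReduced (L ⊗[K] K')

end NoetherianOps

namespace NoetherianOps

section Aux

variable (F S K : Type*) [Field F] [CommRing S] [Field K] [Algebra F S] [Algebra F K]
  [Algebra S K] [IsScalarTower F S K]

/-- The multiplication map `K ⊗ S → K`. -/
noncomputable def auxMul : K ⊗[F] S →ₐ[K] K :=
  Algebra.TensorProduct.lift (AlgHom.id K K) (IsScalarTower.toAlgHom F S K)
    (fun _ _ => Commute.all _ _)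

lemma auxMul_tmul (k : K) (s : S) : auxMul F S K (k ⊗ₜ s) = k * algebraMap S K s := by
  simp [auxMul]

/-- The kernel of the multiplication map. -/
noncomputable def auxKer : Ideal (K ⊗[F] S) := RingHom.ker (auxMul F S K)

lemma mem_auxKer (t : K ⊗[F] S) : t ∈ auxKer F S K ↔ auxMul F S K t = 0 := Iff.rfl

/-- The extended ideal. -/
noncomputable def auxExt (J : Ideal S) : Ideal (K ⊗[F] S) :=
  J.map (Algebra.TensorProduct.includeRight : S →ₐ[F] K ⊗[F] S)

/-- Key flatness step. -/
lemma aux_flat [IsLocalRing S] (hsurj : Function.Surjective (algebraMap S K)) (J : Ideal S) (s : S) (hs : s ∉ J) (u : K ⊗[F] S)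
    (hu : u * (1 ⊗ₜ s) ∈ auxExt F S K J) : auxMul F S K u = 0 := by
  let μ : S →ₗ[F] (S ⧸ J) := (Ideal.Quotient.mkₐ F J).toLinearMap ∘ₗ (LinearMap.mulRight F s)
  have hμ : ∀ x, μ x = Ideal.Quotient.mk J (x * s) := fun x => rfl
  have hker : ∀ x : S, μ x = 0 → algebraMap S K x = 0 := by
    intro x hx
    rw [hμ, Ideal.Quotient.eq_zero_iff_mem] at hx
    have hnu : ¬ IsUnit x := fun h => hs ((Ideal.unit_mul_mem_iff_mem J h).1 hx)
    have hk : RingHom.ker (algebraMap S K) = IsLocalRing.maximalIdeal S :=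
      IsLocalRing.eq_maximalIdeal (RingHom.ker_isMaximal_of_surjective _ hsurj)
    have hx' : x ∈ RingHom.ker (algebraMap S K) := by
      rw [hk]; exact hnu
    exact hx'
  have h1 : LinearMap.lTensor K μ u = 0 := by
    let q : K ⊗[F] S →ₐ[F] K ⊗[F] (S ⧸ J) :=
      Algebra.TensorProduct.map (AlgHom.id F K) (Ideal.Quotient.mkₐ F J)
    have hq : ∀ v ∈ auxExt F S K J, q v = 0 := by
      intro v hv
      have : auxExt F S K J ≤ RingHom.ker q := by
        refine Ideal.map_le_iff_le_comap.2 ?_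
        intro j hj
        have : Ideal.Quotient.mk J j = 0 := Ideal.Quotient.eq_zero_iff_mem.2 hj
        simp [q, RingHom.mem_ker, this]
      exact this hv
    rw [← hq _ hu]
    clear hu
    induction u with
    | zero => simp
    | add a b ha hb => rw [map_add, ha, hb, add_mul, map_add]
    | tmul a b => simp [q, hμ]
  have h2 : Function.Exact (LinearMap.ker μ).subtype μ := LinearMap.exact_subtype_ker_map μ
  obtain ⟨w, rfl⟩ := (Module.Flat.lTensor_exact K h2 u).1 h1
  clear hu h1
  induction w with
  | zero => simp
  | add a b ha hb => rw [map_add, map_add, ha, hb, add_zero]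
  | tmul a b => simp [auxMul_tmul, hker b.1 b.2]

lemma aux_chain [IsLocalRing S] (hsurj : Function.Surjective (algebraMap S K)) (J : Ideal S) [IsArtinianRing (S ⧸ J)]
    [IsNoetherianRing (K ⊗[F] S)] :
    ∃ n : ℕ, ∀ s : S, (1 : K) ⊗ₜ[F] s ∈ auxKer F S K ^ n ⊔ auxExt F S K J → s ∈ J := by
  let f : ℕ → Ideal S := fun n => (auxKer F S K ^ n ⊔ auxExt F S K J).comap
      (Algebra.TensorProduct.includeRight : S →ₐ[F] K ⊗[F] S)
  have hf : Antitone f := fun a b hab =>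
    Ideal.comap_mono (sup_le_sup_right (Ideal.pow_le_pow_right hab) _)
  have hJ : ∀ n, J ≤ f n := fun n => Ideal.map_le_iff_le_comap.1 le_sup_right
  have hmk : Function.Surjective (Ideal.Quotient.mk J) := Ideal.Quotient.mk_surjective
  let g : ℕ →o (Submodule (S ⧸ J) (S ⧸ J))ᵒᵈ :=
    ⟨fun n => OrderDual.toDual ((f n).map (Ideal.Quotient.mk J)),
      fun a b hab => Ideal.map_mono (hf hab)⟩
  obtain ⟨n, hn⟩ := IsArtinian.monotone_stabilizes g
  have hfc : ∀ m, ((f m).map (Ideal.Quotient.mk J)).comap (Ideal.Quotient.mk J) = f m := by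
    intro m
    rw [Ideal.comap_map_of_surjective _ hmk, ← RingHom.ker_eq_comap_bot, Ideal.mk_ker]
    exact sup_eq_left.2 (hJ m)
  have hst : ∀ m, n ≤ m → f n = f m := by
    intro m hm
    have h : (f n).map (Ideal.Quotient.mk J) = (f m).map (Ideal.Quotient.mk J) := hn m hm
    rw [← hfc n, h, hfc m]
  refine ⟨n, fun s hs => ?_⟩
  have hall : ∀ m, (1 : K) ⊗ₜ[F] s ∈ auxKer F S K ^ m ⊔ auxExt F S K J := by
    intro m
    have h0 : s ∈ f n := hs
    rw [hst (max n m) (le_max_left _ _)] at h0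
    exact hf (le_max_right n m) h0
  have hx := (Ideal.mem_iInf_smul_pow_eq_bot_iff (auxKer F S K)
    (M := (K ⊗[F] S) ⧸ auxExt F S K J) (Ideal.Quotient.mk _ ((1 : K) ⊗ₜ[F] s))).1 (by
      rw [Submodule.mem_iInf]
      intro m
      obtain ⟨y, hy, z, hz, hyz⟩ := Submodule.mem_sup.1 (hall m)
      rw [← hyz, map_add, Ideal.Quotient.eq_zero_iff_mem.2 hz, add_zero]
      have : (Ideal.Quotient.mk (auxExt F S K J)) y
        = y • (1 : (K ⊗[F] S) ⧸ auxExt F S K J) := by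
        change Ideal.Quotient.mk _ y = Ideal.Quotient.mk _ (y * 1)
        rw [mul_one]
      rw [this]
      exact Submodule.smul_mem_smul hy trivial)
  obtain ⟨⟨r, hr⟩, hrx⟩ := hx
  by_contra hsJ
  have h := aux_flat F S K hsurj J s hsJ (r - 1) (by
    rw [← Ideal.Quotient.eq_zero_iff_mem, sub_mul, map_sub, map_mul, one_mul, sub_eq_zero]
    exact hrx)
  rw [map_sub, (mem_auxKer F S K r).1 hr] at h
  simp at h

lemma aux_finite [IsNoetherianRing (K ⊗[F] S)] (n : ℕ) :
    ∃ V : Submodule K (K ⊗[F] S), V.FG ∧ V ⊔ (auxKer F S K ^ n).restrictScalars K = ⊤ := by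
  induction n with
  | zero => exact ⟨⊥, Submodule.fg_bot, by simp⟩
  | succ n ih =>
    obtain ⟨V, hV, hVt⟩ := ih
    obtain ⟨s, hs⟩ := (IsNoetherian.noetherian (auxKer F S K ^ n) : (auxKer F S K ^ n).FG)
    refine ⟨V ⊔ Submodule.span K (s : Set _), hV.sup ⟨s, rfl⟩, ?_⟩
    rw [eq_top_iff, ← hVt, sup_assoc]
    refine sup_le le_sup_left (le_trans ?_ le_sup_right)
    intro t ht
    have ht' : t ∈ Submodule.span (K ⊗[F] S) (s : Set _) := by rw [hs]; exact ht
    clear ht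
    induction ht' using Submodule.span_induction with
    | zero => exact zero_mem _
    | mem x hx => exact Submodule.mem_sup_left (Submodule.subset_span hx)
    | add x y _ _ hx hy => exact add_mem hx hy
    | smul a x hxs hx =>
      have hxn : x ∈ auxKer F S K ^ n := by rw [← hs]; exact hxs
      have h1 : a • x = (auxMul F S K a) • x
          + (a - algebraMap K _ (auxMul F S K a)) * x := by
        rw [sub_mul, ← Algebra.smul_def, smul_eq_mul]; abel
      rw [h1]
      refine add_mem (Submodule.smul_mem _ _ hx) (Submodule.mem_sup_right ?_)
      change _ ∈ auxKer F S K ^ (n + 1)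
      rw [pow_succ']
      refine Ideal.mul_mem_mul ?_ hxn
      rw [mem_auxKer, map_sub, AlgHom.commutes]; simp

lemma aux_fg [IsNoetherianRing (K ⊗[F] S)] (n : ℕ) (W : Submodule K (K ⊗[F] S))
    (hW : (auxKer F S K ^ n).restrictScalars K ≤ W) : W.dualAnnihilator.FG := by
  obtain ⟨V, hV, hVt⟩ := aux_finite F S K n
  have hfin : Module.Finite K ((K ⊗[F] S) ⧸ W) := by
    refine ⟨?_⟩
    have : V.map W.mkQ = ⊤ := by
      rw [← Submodule.comap_injective_of_surjective (W.mkQ_surjective) |>.eq_iff]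
      rw [Submodule.comap_map_mkQ, Submodule.comap_top, eq_top_iff, ← hVt]
      exact sup_le le_sup_right (hW.trans le_sup_left)
    rw [← this]
    exact hV.map _
  have : Module.Finite K W.dualAnnihilator :=
    Module.Finite.equiv W.dualQuotEquivDualAnnihilator
  exact (Submodule.fg_iff_finiteDimensional _).2 this

end Aux

section Ops

variable (A R F S K : Type*) [CommRing A] [CommRing R] [Algebra A R]
  [Field F] [CommRing S] [Field K] [Algebra F S] [Algebra F K]
  [Algebra S K] [IsScalarTower F S K] [Algebra A F] [Algebra A S] [Algebra A K] [Algebra R S]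
  [Algebra R K] [IsScalarTower A R S] [IsScalarTower A R K] [IsScalarTower A F S]
  [IsScalarTower A F K] [IsScalarTower R S K]

/-- The operator attached to a functional on `K ⊗ S`. -/
noncomputable def auxOp : Module.Dual K (K ⊗[F] S) →ₗ[K] (R →ₗ[A] K) where
  toFun φ :=
    { toFun := fun r => φ (1 ⊗ₜ algebraMap R S r)
      map_add' := fun x y => by rw [map_add, TensorProduct.tmul_add, map_add]
      map_smul' := fun a x => by
        have h1 : algebraMap R S (a • x) = algebraMap A F a • algebraMap R S x := by
          rw [Algebra.smul_def a x, map_mul, ← IsScalarTower.algebraMap_apply,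
            Algebra.smul_def, ← IsScalarTower.algebraMap_apply]
        have h2 : (1 : K) ⊗ₜ[F] (algebraMap A F a • algebraMap R S x)
            = algebraMap A K a • ((1 : K) ⊗ₜ[F] algebraMap R S x) := by
          rw [← TensorProduct.smul_tmul, TensorProduct.smul_tmul', Algebra.smul_def,
            ← IsScalarTower.algebraMap_apply]; rfl
        rw [h1, h2, map_smul, RingHom.id_apply, algebraMap_smul] }
  map_add' φ ψ := rfl
  map_smul' k φ := rfl

@[simp] lemma auxOp_apply (φ : Module.Dual K (K ⊗[F] S)) (r : R) :
    auxOp A R F S K φ r = φ (1 ⊗ₜ algebraMap R S r) := rfl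

lemma auxOp_preSMul (φ : Module.Dual K (K ⊗[F] S)) (r : R) :
    preSMul A R R K r (auxOp A R F S K φ)
      = auxOp A R F S K (φ ∘ₗ LinearMap.mulLeft K (1 ⊗ₜ algebraMap R S r)) := by
  ext x
  simp

lemma auxOp_bracket (φ : Module.Dual K (K ⊗[F] S)) (r : R) :
    opBracket A R R K r (auxOp A R F S K φ)
      = auxOp A R F S K (φ ∘ₗ LinearMap.mulLeft K
        (1 ⊗ₜ algebraMap R S r - algebraMap K (K ⊗[F] S) (algebraMap R K r))) := by
  ext x
  simp only [opBracket_apply, auxOp_apply, LinearMap.comp_apply, LinearMap.mulLeft_apply, sub_mul,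
    ← Algebra.smul_def, map_sub, map_smul, smul_eq_mul, map_mul,
    Algebra.TensorProduct.tmul_mul_tmul, one_mul]

lemma auxOp_diff (n : ℕ) (φ : Module.Dual K (K ⊗[F] S))
    (hφ : ∀ t ∈ auxKer F S K ^ (n + 1), φ t = 0) : auxOp A R F S K φ ∈ DiffLE A R R K n := by
  have hmem : ∀ r : R, (1 ⊗ₜ algebraMap R S r - algebraMap K (K ⊗[F] S) (algebraMap R K r))
      ∈ auxKer F S K := by
    intro r
    rw [mem_auxKer, map_sub, AlgHom.commutes, auxMul_tmul, one_mul,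
      ← IsScalarTower.algebraMap_apply]
    simp
  induction n generalizing φ with
  | zero =>
    intro r
    rw [auxOp_bracket]
    ext x
    simp only [auxOp_apply, LinearMap.comp_apply, LinearMap.mulLeft_apply, LinearMap.zero_apply]
    apply hφ
    rw [zero_add, pow_one]
    exact Ideal.mul_mem_right _ _ (hmem r)
  | succ n ih =>
    intro r
    rw [auxOp_bracket]
    apply ih
    intro t ht
    apply hφ
    rw [pow_succ']
    exact Ideal.mul_mem_mul (hmem r) ht

end Ops

/-- **Primary ideals as solution sets of differential operators** (Theorem 3.10(i)).
Let `R` be a Noetherian ring and `A ⊆ R` a subring which is a Noetherian integral domain,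
with fraction field `FA = Quot(A)`.  Let `p` be a prime of `R` with `p ∩ A = 0`, let
`Rp = R_p` and let `K = k(p) = R_p/pR_p` be the residue field.  If `k(p) ⊗_{Quot A} R_p`
is Noetherian, then every `p`-primary ideal `I` of `R` is the solution set of an
`(R ⊗[A] R)`-submodule `E ⊆ Diff_{R/A}(R, k(p))` which is finitely generated for the left
(post-composition) `R_p`-module structure. -/
theorem primary_ideal_eq_sol
    (A R : Type*) [CommRing A] [CommRing R] [IsDomain A]
    [IsNoetherianRing A] [IsNoetherianRing R] [Algebra A R]
    (hAR : Function.Injective (algebraMap A R))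
    (p : Ideal R) [p.IsPrime]
    (hpA : ∀ a : A, algebraMap A R a ∈ p → a = 0)
    (FA : Type*) [Field FA] [Algebra A FA] [IsFractionRing A FA]
    (Rp : Type*) [CommRing Rp] [Algebra R Rp] [IsLocalization.AtPrime Rp p]
    [Algebra A Rp] [IsScalarTower A R Rp] [Algebra FA Rp] [IsScalarTower A FA Rp]
    (K : Type*) [Field K] [Algebra Rp K]
    (hsurj : Function.Surjective (algebraMap Rp K))
    (hker : RingHom.ker (algebraMap Rp K) = p.map (algebraMap R Rp))
    [Algebra R K] [IsScalarTower R Rp K] [Algebra A K] [IsScalarTower A R K]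
    [IsScalarTower A Rp K] [Algebra FA K] [IsScalarTower A FA K]
    (hNoeth : IsNoetherianRing (K ⊗[FA] Rp))
    (I : Ideal R) (hIp : I.IsPrimary) (hrad : I.radical = p) :
    ∃ E : Set (R →ₗ[A] K),
      E ⊆ Diff A R R K ∧ IsTensorSubmodule A R R K E ∧
      (I : Set R) = Sol E ∧ IsFGLeft Rp E := by
  have : IsLocalRing Rp := IsLocalization.AtPrime.isLocalRing Rp p
  have : IsNoetherianRing Rp := IsLocalization.isNoetherianRing p.primeCompl Rp inferInstance
  have : IsScalarTower FA Rp K := by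
    refine IsScalarTower.of_algebraMap_eq' ?_
    refine IsLocalization.ringHom_ext (nonZeroDivisors A) ?_
    ext a
    simp only [RingHom.comp_apply]
    rw [← IsScalarTower.algebraMap_apply A FA K, ← IsScalarTower.algebraMap_apply A FA Rp,
      ← IsScalarTower.algebraMap_apply A Rp K]
  have hmax : IsLocalRing.maximalIdeal Rp = p.map (algebraMap R Rp) := by
    rw [← hker]
    exact (IsLocalRing.eq_maximalIdeal (RingHom.ker_isMaximal_of_surjective _ hsurj)).symm
  set J : Ideal Rp := I.map (algebraMap R Rp) with hJdef
  have hIle : I ≤ p := hrad ▸ Ideal.le_radical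
  have : IsArtinianRing (Rp ⧸ J) := by
    apply IsLocalRing.quotient_artinian_of_mem_minimalPrimes_of_isLocalRing
    refine ⟨⟨inferInstance, ?_⟩, ?_⟩
    · rw [hmax]; exact Ideal.map_mono hIle
    · rintro q ⟨hq, hJq⟩ _
      rw [hmax, Ideal.map_le_iff_le_comap, ← hrad]
      have := hq
      exact (Ideal.IsPrime.radical_le_iff (Ideal.comap_isPrime (algebraMap R Rp) q)).2
        (Ideal.map_le_iff_le_comap.1 hJq)
  have hcontr : ∀ r : R, algebraMap R Rp r ∈ J → r ∈ I := by
    intro r hr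
    obtain ⟨⟨x, m⟩, hx⟩ := (IsLocalization.mem_map_algebraMap_iff p.primeCompl Rp).1 hr
    rw [← map_mul] at hx
    obtain ⟨c, hc⟩ := (IsLocalization.eq_iff_exists p.primeCompl Rp).1 hx
    have h1 : r * ((c : R) * (m : R)) ∈ I := by
      have : r * ((c : R) * (m : R)) = c * x := by rw [← hc]; ring
      rw [this]
      exact I.mul_mem_left _ x.2
    rcases (Ideal.isPrimary_iff.1 hIp).2 h1 with h | h
    · exact h
    · rw [hrad] at h
      exact absurd h (p.primeCompl.mul_mem c.2 m.2)
  obtain ⟨n, hn⟩ := aux_chain FA Rp K hsurj J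
  -- shift so that the order is controlled
  let W : Ideal (K ⊗[FA] Rp) := auxKer FA Rp K ^ (n + 1) ⊔ auxExt FA Rp K J
  have hW : ∀ s : Rp, (1 : K) ⊗ₜ[FA] s ∈ W → s ∈ J := by
    intro s hs
    have hle : W ≤ auxKer FA Rp K ^ n ⊔ auxExt FA Rp K J :=
      sup_le_sup_right (Ideal.pow_le_pow_right n.le_succ) _
    exact hn s (hle hs)
  let D : Submodule K (Module.Dual K (K ⊗[FA] Rp)) := (W.restrictScalars K).dualAnnihilator
  have hD : D.FG := aux_fg FA Rp K (n + 1) _ (fun x hx => (le_sup_left : _ ≤ W) hx)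
  have hDmem : ∀ φ, φ ∈ D ↔ ∀ t ∈ W, φ t = 0 := fun φ => Submodule.mem_dualAnnihilator φ
  let E : Submodule K (R →ₗ[A] K) := D.map (auxOp A R FA Rp K)
  have hE : E.FG := hD.map _
  refine ⟨E, ?_, ⟨zero_mem E, fun _ h _ h' => add_mem h h', fun _ h => neg_mem h, ?_, ?_⟩, ?_, ?_⟩
  · rintro _ ⟨φ, hφ, rfl⟩
    exact ⟨n, auxOp_diff A R FA Rp K n φ fun t ht =>
      (hDmem φ).1 hφ t ((le_sup_left : _ ≤ W) ht)⟩
  · intro r δ hδ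
    have : r • δ = algebraMap R K r • δ := by
      ext x; simp [Algebra.smul_def]
    rw [this]
    exact E.smul_mem _ hδ
  · rintro r _ ⟨φ, hφ, rfl⟩
    rw [auxOp_preSMul]
    refine ⟨_, (hDmem _).2 fun t ht => ?_, rfl⟩
    exact (hDmem φ).1 hφ _ (W.mul_mem_left _ ht)
  · ext r
    constructor
    · rintro hr _ ⟨φ, hφ, rfl⟩
      refine (hDmem φ).1 hφ _ ((le_sup_right : _ ≤ W) ?_)
      exact Ideal.mem_map_of_mem (Algebra.TensorProduct.includeRight : Rp →ₐ[FA] K ⊗[FA] Rp)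
        (Ideal.mem_map_of_mem (algebraMap R Rp) hr)
    · intro hr
      apply hcontr
      apply hW
      refine (Subspace.forall_mem_dualAnnihilator_apply_eq_zero_iff (W.restrictScalars K) _).1 ?_
      intro φ hφ
      exact hr _ ⟨φ, hφ, rfl⟩
  · obtain ⟨s, hs⟩ := hE
    refine ⟨s, fun x hx => by rw [← hs]; exact Submodule.subset_span hx, fun δ hδ => ?_⟩
    have hδ' : δ ∈ Submodule.span K (s : Set (R →ₗ[A] K)) := by rw [hs]; exact hδ
    obtain ⟨c, _, hc⟩ := Submodule.mem_span_finset.1 hδ'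
    choose l hl using hsurj
    refine ⟨fun g => l (c g), ?_⟩
    rw [← hc]
    refine Finset.sum_congr rfl fun g _ => ?_
    ext x
    simp [Algebra.smul_def, hl]

end NoetherianOps
end

section
/- Let A be a Noetherian integral domain and R a Noetherian commutative ring containing A as a subring, such that R is a formally smooth A-algebra and essentially of finite type over A. Let p be a prime ideal of R with p ∩ A = 0. Then for every p-primary ideal I of R there exists an (R ⊗_A R)-submodule E ⊆ Diff_{R/A}(R, R) such that I = {f ∈ R | δ(f) ∈ p for all δ ∈ E}, and E is finitely generated as an R-module via the left (post-composition) module structure. -/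
set_option linter.unusedSectionVars false

open scoped TensorProduct

namespace NoetherianOps

open scoped TensorProduct

lemma chain_stab {R : Type*} [CommRing R] [IsNoetherianRing R] (p : Ideal R) [p.IsPrime]
    (I : Ideal R) (hrad : I.radical = p) (a : ℕ → Ideal R) (ha : Antitone a)
    (hIa : ∀ n, I ≤ a n) (hsat : ∀ n s x, s ∉ p → s * x ∈ a n → x ∈ a n) :
    ∃ N, ∀ n, a N ≤ a n := by
  let L := Localization.AtPrime p
  let IL : Ideal L := I.map (algebraMap R L)
  have hIp : I ≤ p := hrad ▸ Ideal.le_radical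
  have hle : IL ≤ IsLocalRing.maximalIdeal L := by
    rw [← Localization.AtPrime.map_eq_maximalIdeal]
    exact Ideal.map_mono hIp
  have hne : IL ≠ ⊤ := fun h => (IsLocalRing.maximalIdeal.isMaximal L).ne_top
    (top_le_iff.mp (h ▸ hle))
  have : Nontrivial (L ⧸ IL) := Ideal.Quotient.nontrivial_iff.mpr hne
  have : IsLocalRing (L ⧸ IL) := .of_surjective' (Ideal.Quotient.mk IL) Ideal.Quotient.mk_surjective
  have : IsArtinianRing (L ⧸ IL) := by
    rw [isArtinianRing_iff_isNilpotent_maximalIdeal]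
    obtain ⟨e, he⟩ := Ideal.exists_radical_pow_le_of_fg I (IsNoetherian.noetherian _)
    rw [hrad] at he
    refine ⟨e, ?_⟩
    have h1 : IsLocalRing.maximalIdeal (L ⧸ IL) ≤
        (IsLocalRing.maximalIdeal L).map (Ideal.Quotient.mk IL) := by
      intro x hx
      obtain ⟨y, rfl⟩ := Ideal.Quotient.mk_surjective x
      refine Ideal.mem_map_of_mem _ ?_
      rw [IsLocalRing.mem_maximalIdeal, mem_nonunits_iff] at hx ⊢
      exact fun h => hx (h.map _)
    rw [Ideal.zero_eq_bot, eq_bot_iff]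
    refine (Ideal.pow_right_mono h1 e).trans ?_
    rw [← Localization.AtPrime.map_eq_maximalIdeal, ← Ideal.map_pow, ← Ideal.map_pow]
    refine (Ideal.map_mono (Ideal.map_mono he)).trans ?_
    rw [Ideal.map_quotient_self]
  let F : ℕ →o (Submodule (L ⧸ IL) (L ⧸ IL))ᵒᵈ :=
    ⟨fun n => OrderDual.toDual (((a n).map (algebraMap R L)).map (Ideal.Quotient.mk IL)),
      fun i j hij => OrderDual.toDual_le_toDual.mpr (Ideal.map_mono (Ideal.map_mono (ha hij)))⟩
  obtain ⟨N, hN⟩ := IsArtinian.monotone_stabilizes F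
  refine ⟨N, fun n => ?_⟩
  rcases le_total n N with h | h
  · exact ha h
  have hh : ((a N).map (algebraMap R L)).map (Ideal.Quotient.mk IL) =
    ((a n).map (algebraMap R L)).map (Ideal.Quotient.mk IL) := hN n h
  intro x hx
  have h2 : Ideal.Quotient.mk IL (algebraMap R L x) ∈
      ((a n).map (algebraMap R L)).map (Ideal.Quotient.mk IL) := by
    rw [← hh]
    exact Ideal.mem_map_of_mem _ (Ideal.mem_map_of_mem _ hx)
  rw [Ideal.mem_quotient_iff_mem (Ideal.map_mono (hIa n))] at h2
  rw [IsLocalization.mem_map_algebraMap_iff p.primeCompl] at h2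
  obtain ⟨⟨y, s⟩, hys⟩ := h2
  rw [← map_mul, IsLocalization.eq_iff_exists p.primeCompl] at hys
  obtain ⟨c, hc⟩ := hys
  refine hsat n (c * s) x (c * s).2 ?_
  have : (c : R) * s * x = c * y := by rw [← hc]; ring
  rw [this]
  exact Ideal.mul_mem_left _ _ y.2

lemma flat_separation {R T : Type*} [CommRing R] [IsNoetherianRing R] [CommRing T]
    [IsNoetherianRing T] [Algebra R T] [Module.Flat R T] (p : Ideal R) [p.IsPrime]
    (I : Ideal R) (hIp : I.IsPrimary) (hrad : I.radical = p) (m : Ideal T) [hm : m.IsMaximal]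
    (hmp : m.comap (algebraMap R T) = p) :
    ∃ N : ℕ, ∀ n, N ≤ n → ∀ f : R, algebraMap R T f ∈ I.map (algebraMap R T) ⊔ m ^ n → f ∈ I := by
  let a : ℕ → Ideal R := fun n => (I.map (algebraMap R T) ⊔ m ^ n).comap (algebraMap R T)
  have ha : Antitone a := fun i j hij =>
    Ideal.comap_mono (sup_le_sup_left (Ideal.pow_le_pow_right hij) _)
  obtain ⟨N, hN⟩ := chain_stab p I hrad a ha
    (fun n => Ideal.map_le_iff_le_comap.mp le_sup_left) (by
      intro n s x hs hx
      have hs' : algebraMap R T s ∉ m := fun h => hs (hmp ▸ h)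
      obtain ⟨t, ht⟩ := hm.exists_inv hs'
      obtain ⟨i, hi, hti⟩ := ht
      have hcop : IsCoprime (algebraMap R T s) (i ^ n) := by
        apply IsCoprime.pow_right
        exact ⟨t, 1, by rw [one_mul]; exact hti⟩
      obtain ⟨u, v, huv⟩ := hcop
      change algebraMap R T x ∈ I.map (algebraMap R T) ⊔ m ^ n
      have hx' : algebraMap R T (s * x) ∈ (I.map (algebraMap R T) ⊔ m ^ n) := hx
      have : algebraMap R T x = u * algebraMap R T (s * x) + v * algebraMap R T x * i ^ n := by
        rw [map_mul]; linear_combination (- algebraMap R T x) * huv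
      rw [this]
      exact Ideal.add_mem _ (Ideal.mul_mem_left _ _ hx')
        (Ideal.mul_mem_left _ _ (Ideal.mem_sup_right (Ideal.pow_mem_pow hi n))))
  refine ⟨N, fun n hn f hf => ?_⟩
  have hall : ∀ j, algebraMap R T f ∈ I.map (algebraMap R T) ⊔ m ^ j := fun j => hN j (ha hn hf)
  -- Krull
  let J := I.map (algebraMap R T)
  have hK : Ideal.Quotient.mk J (algebraMap R T f) ∈
      (⨅ i : ℕ, m ^ i • ⊤ : Submodule T (T ⧸ J)) := by
    rw [Submodule.mem_iInf]
    intro i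
    obtain ⟨y, hy, z, hz, hyz⟩ := Submodule.mem_sup.mp (hall i)
    rw [← hyz, map_add, Ideal.Quotient.eq_zero_iff_mem.mpr hy, zero_add]
    have : Ideal.Quotient.mk J z = z • (1 : T ⧸ J) := by
      rw [Algebra.smul_def, mul_one]; rfl
    rw [this]
    exact Submodule.smul_mem_smul hz trivial
  rw [Ideal.mem_iInf_smul_pow_eq_bot_iff] at hK
  obtain ⟨r, hr⟩ := hK
  have hr' : (1 - (r : T)) * algebraMap R T f ∈ J := by
    rw [← Ideal.Quotient.eq_zero_iff_mem, sub_mul, one_mul, map_sub, map_mul, sub_eq_zero]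
    rw [Algebra.smul_def] at hr
    exact hr.symm
  by_contra hfI
  -- equational criterion
  obtain ⟨k, b, hb, t, hsum⟩ : ∃ (k : ℕ) (b : Fin k → R) (_ : ∀ i, b i ∈ I) (t : Fin k → T),
      (1 - (r : T)) * algebraMap R T f = ∑ i, b i • t i := by
    have h := hr'
    change _ ∈ Ideal.span _ at h
    rw [Ideal.span, Submodule.mem_span_image_iff_exists_fun] at h
    obtain ⟨s, hs, c, hc⟩ := h
    refine ⟨_, fun i => s.equivFin.symm i, fun i => hs (s.equivFin.symm i).2,
      fun i => c (s.equivFin.symm i), ?_⟩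
    rw [← hc, Equiv.sum_comp s.equivFin.symm (fun i : s => (i : R) • c i)]
    refine Finset.sum_congr rfl fun i _ => ?_
    rw [Algebra.smul_def (i : R), smul_eq_mul, mul_comm]
  have hrel : ∑ i : Option (Fin k), (Option.elim i f (fun j => - b j)) •
      (Option.elim i (1 - (r : T)) t) = 0 := by
    rw [Fintype.sum_option]
    simp only [Option.elim, neg_smul, Finset.sum_neg_distrib, ← hsum]
    rw [Algebra.smul_def]
    ring
  obtain ⟨l, c, y, h1, h2⟩ := Module.Flat.isTrivialRelation_of_sum_smul_eq_zero (R := R) (M := T) hrel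
  have h3 : ∀ j, c none j ∈ p := by
    intro j
    have := h2 j
    rw [Fintype.sum_option] at this
    simp only [Option.elim] at this
    have h4 : f * c none j ∈ I := by
      rw [eq_neg_of_add_eq_zero_left this]
      exact neg_mem (Ideal.sum_mem _ fun i _ => Ideal.mul_mem_right _ _ (neg_mem (hb i)))
    rcases (Ideal.isPrimary_iff.mp hIp).2 h4 with h | h
    · exact absurd h hfI
    · exact hrad ▸ h
  have h5 : 1 - (r : T) ∈ m := by
    have := h1 none
    simp only [Option.elim] at this
    rw [this]
    refine Ideal.sum_mem _ fun j _ => ?_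
    rw [Algebra.smul_def]
    exact Ideal.mul_mem_right _ _ (show c none j ∈ m.comap (algebraMap R T) from hmp ▸ h3 j)
  apply hm.ne_top
  rw [Ideal.eq_top_iff_one]
  simpa using Ideal.add_mem _ h5 r.2

end NoetherianOps

namespace NoetherianOps

open scoped TensorProduct

/-- A deformation `φ` of the quotient map `T → T/m^n` which agrees with it modulo `m²` is injective
modulo `m^n`. -/
lemma ker_le_pow {T : Type*} [CommRing T] (m : Ideal T) (n : ℕ)
    (φ : T →+* T ⧸ m ^ n)
    (hφ : ∀ t, φ t - Ideal.Quotient.mk (m ^ n) t ∈ (m.map (Ideal.Quotient.mk (m ^ n))) ^ 2)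
    (x : T) (hx : φ x = 0) : x ∈ m ^ n := by
  set M := m.map (Ideal.Quotient.mk (m ^ n)) with hM
  have hm : ∀ b ∈ m, φ b ∈ M := by
    intro b hb
    have := Ideal.add_mem _ (Ideal.pow_le_self two_ne_zero (hφ b))
      (Ideal.mem_map_of_mem (Ideal.Quotient.mk (m ^ n)) hb)
    simpa using this
  have key : ∀ j, ∀ x ∈ m ^ j, φ x - Ideal.Quotient.mk (m ^ n) x ∈ M ^ (j + 1) := by
    intro j
    induction j with
    | zero => intro x _; simpa using Ideal.pow_le_self two_ne_zero (hφ x)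
    | succ j ih =>
      intro x hx
      rw [pow_succ] at hx
      refine Submodule.mul_induction_on hx ?_ ?_
      · intro a ha b hb
        have h1 := Ideal.mul_mem_mul (ih a ha) (hm b hb)
        have h2 := Ideal.mul_mem_mul (Ideal.mem_map_of_mem (Ideal.Quotient.mk (m ^ n)) ha) (hφ b)
        rw [Ideal.map_pow, ← hM, ← pow_add] at h2
        rw [← pow_succ] at h1
        have := Ideal.add_mem _ h1 h2
        convert this using 1
        rw [map_mul, map_mul]; ring
      · intro a b ha hb
        have := Ideal.add_mem _ ha hb
        convert this using 1
        rw [map_add, map_add]; ring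
  have : ∀ j, j ≤ n → x ∈ m ^ j := by
    intro j
    induction j with
    | zero => intro _; simp
    | succ j ih =>
      intro hj
      have h := key j x (ih (by omega))
      rw [hx, zero_sub, neg_mem_iff, hM, ← Ideal.map_pow,
        Ideal.mem_quotient_iff_mem (Ideal.pow_le_pow_right hj)] at h
      exact h
  exact this n le_rfl

/-- Functionals composed with an algebra map which is the identity modulo a nilpotent ideal are
differential operators. -/
lemma comp_mem_DiffLE {A R F : Type*} [CommRing A] [CommRing R] [Algebra A R] [CommRing F]
    [Algebra A F] [Algebra R F] [IsScalarTower A R F] (N : Ideal F) (g : R →ₐ[A] F)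
    (hg : ∀ r, g r - algebraMap R F r ∈ N) (n : ℕ) :
    ∀ (l : F →ₗ[R] R), (∀ x ∈ N ^ (n + 1), l x = 0) →
      (l.restrictScalars A).comp g.toLinearMap ∈ DiffLE A R R R n := by
  have hb : ∀ (l : F →ₗ[R] R) (r : R),
      opBracket A R R R r ((l.restrictScalars A).comp g.toLinearMap) =
      ((l.comp (LinearMap.mulLeft R (g r - algebraMap R F r))).restrictScalars A).comp
        g.toLinearMap := by
    intro l r
    ext x
    simp only [opBracket_apply, LinearMap.comp_apply, LinearMap.restrictScalars_apply,
      AlgHom.toLinearMap_apply, smul_eq_mul, map_mul, LinearMap.mulLeft_apply, sub_mul, map_sub]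
    rw [← Algebra.smul_def, map_smul, smul_eq_mul]
  induction n with
  | zero =>
    intro l hl r
    rw [hb]
    ext x
    exact hl _ (by simpa using Ideal.mul_mem_right _ _ (hg r))
  | succ n ih =>
    intro l hl r
    rw [hb]
    apply ih
    intro x hx
    apply hl
    rw [pow_succ']
    exact Ideal.mul_mem_mul (hg r) hx

/-- Freeness and finiteness of truncated polynomial rings. -/
lemma truncated_free (R : Type*) [CommRing R] (ι : Type*) [Finite ι] (n : ℕ) :
    Module.Finite R (MvPolynomial ι R ⧸ (MvPolynomial.idealOfVars ι R) ^ n) ∧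
    Module.Free R (MvPolynomial ι R ⧸ (MvPolynomial.idealOfVars ι R) ^ n) := by
  classical
  have hfin : Finite {a : ι →₀ ℕ // a.degree < n} := by
    have := Finsupp.finite_of_degree_le (σ := ι) n
    exact (this.subset (fun a (ha : a.degree < n) => ha.le)).to_subtype
  let S := {a : ι →₀ ℕ // a.degree < n}
  let q : MvPolynomial ι R →ₗ[R] (S → R) := LinearMap.pi fun a => MvPolynomial.lcoeff R a.1
  have hq : Function.Surjective q := by
    intro v
    have := Fintype.ofFinite S
    refine ⟨∑ a : S, MvPolynomial.monomial a.1 (v a), ?_⟩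
    funext b
    simp only [q, LinearMap.pi_apply, map_sum, MvPolynomial.lcoeff_apply,
      MvPolynomial.coeff_monomial]
    rw [Finset.sum_eq_single b]
    · simp
    · intro c _ hc
      rw [if_neg (fun h => hc (Subtype.ext h))]
    · simp
  have hker : LinearMap.ker q =
      ((MvPolynomial.idealOfVars ι R) ^ n).restrictScalars R := by
    ext f
    rw [LinearMap.mem_ker, Submodule.restrictScalars_mem, MvPolynomial.mem_pow_idealOfVars_iff']
    constructor
    · intro h x hx
      exact congrFun h ⟨x, hx⟩
    · intro h
      funext x
      exact h x.1 x.2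
  let e : (MvPolynomial ι R ⧸ (MvPolynomial.idealOfVars ι R) ^ n) ≃ₗ[R] (S → R) :=
    (Submodule.Quotient.restrictScalarsEquiv R _).symm.trans
      ((Submodule.quotEquivOfEq _ _ hker.symm).trans (q.quotKerEquivOfSurjective hq))
  exact ⟨Module.Finite.equiv e.symm, Module.Free.of_equiv e.symm⟩

/-- Clearing denominators of a functional. -/
lemma clear_denoms {R k F : Type*} [CommRing R] [Field k] [Algebra R k] [AddCommGroup F]
    [Module R F] [Module.Finite R F] [Module.Free R F] (p : Ideal R) [p.IsPrime]
    (hk : ∀ x : k, ∃ c : R, c ∉ p ∧ ∃ r : R, c • x = algebraMap R k r)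
    (μ : F →ₗ[R] k) :
    ∃ (l : F →ₗ[R] R) (c : R), c ∉ p ∧ ∀ x, algebraMap R k (l x) = c • μ x := by
  classical
  let b := Module.Free.chooseBasis R F
  choose c hc r hr using fun i => hk (μ (b i))
  refine ⟨b.constr R (fun i => (∏ j ∈ Finset.univ.erase i, c j) * r i), ∏ i, c i, ?_, ?_⟩
  · rw [Ideal.IsPrime.prod_mem_iff]
    rintro ⟨i, _, hi⟩
    exact hc i hi
  · intro x
    have : (Algebra.linearMap R k).comp
        (b.constr R (fun i => (∏ j ∈ Finset.univ.erase i, c j) * r i)) = (∏ i, c i) • μ := by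
      apply b.ext
      intro i
      simp only [LinearMap.comp_apply, Module.Basis.constr_basis, Algebra.linearMap_apply,
        map_mul, LinearMap.smul_apply]
      rw [← hr i, ← Finset.prod_erase_mul _ _ (Finset.mem_univ i), mul_smul, ← Algebra.smul_def]
    exact LinearMap.congr_fun this x

end NoetherianOps

namespace NoetherianOps

open scoped TensorProduct
open MvPolynomial (idealOfVars)

lemma exists_kaehler_section (A R : Type*) [CommRing A] [CommRing R] [Algebra A R]
    [Algebra.FormallySmooth A R] [Algebra.EssFiniteType A R] :
    ∃ (t : Finset R) (s : Ω[R⁄A] →ₗ[R] (t → R)),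
      ∀ w, w = ∑ i, s w i • KaehlerDifferential.D A R (i : R) := by
  classical
  have hfg : (Submodule.span R (Set.range (KaehlerDifferential.D A R))).FG := by
    rw [KaehlerDifferential.span_range_derivation]
    exact Module.Finite.fg_top
  rw [Submodule.fg_span_iff_fg_span_finset_subset] at hfg
  obtain ⟨s', hs', hspan⟩ := hfg
  obtain ⟨t, ht⟩ : ∃ t : Finset R, t.image (KaehlerDifferential.D A R) = s' := by
    have := Finset.subset_set_image_iff (s := Set.univ) (t := s') (f := KaehlerDifferential.D A R)
    obtain ⟨t, _, ht⟩ := this.mp (by simpa using hs')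
    exact ⟨t, ht⟩
  let q : (t → R) →ₗ[R] Ω[R⁄A] :=
    Fintype.linearCombination R (fun i : t => KaehlerDifferential.D A R (i : R))
  have hq : Function.Surjective q := by
    rw [← LinearMap.range_eq_top, Fintype.range_linearCombination,
      ← KaehlerDifferential.span_range_derivation, hspan, ← ht]
    congr 1
    ext w
    simp
  obtain ⟨s, hs⟩ := Module.projective_lifting_property q LinearMap.id hq
  refine ⟨t, s, fun w => ?_⟩
  have := LinearMap.congr_fun hs w
  rw [LinearMap.comp_apply, LinearMap.id_apply] at this
  conv_lhs => rw [← this]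
  rfl

lemma exists_g {A R : Type*} [CommRing A] [CommRing R] [Algebra A R]
    [Algebra.FormallySmooth A R] {ι : Type*} [Fintype ι]
    (s : Ω[R⁄A] →ₗ[R] (ι → R)) (n : ℕ) (hn : 2 ≤ n) :
    ∃ g : R →ₐ[A] MvPolynomial ι R ⧸ (idealOfVars ι R) ^ n,
      ∀ r, ∃ P : MvPolynomial ι R, Ideal.Quotient.mk _ P = g r ∧
        P - (MvPolynomial.C r + ∑ i, MvPolynomial.C (s (KaehlerDifferential.D A R r) i) *
          MvPolynomial.X i) ∈ (idealOfVars ι R) ^ 2 := by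
  classical
  set V := idealOfVars ι R with hV
  let L : R →ₗ[A] MvPolynomial ι R :=
    { toFun := fun r => ∑ i, MvPolynomial.C (s (KaehlerDifferential.D A R r) i) *
          MvPolynomial.X i
      map_add' := by
        intro a b
        simp [add_mul, Finset.sum_add_distrib]
      map_smul' := by
        intro a b
        rw [Derivation.map_smul, ← algebraMap_smul R a, map_smul]
        simp only [Pi.smul_apply, smul_eq_mul, map_mul, RingHom.id_apply, Finset.smul_sum]
        refine Finset.sum_congr rfl fun i _ => ?_
        rw [Algebra.smul_def, mul_assoc, IsScalarTower.algebraMap_apply A R (MvPolynomial ι R)]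
        rfl }
  have hLmul : ∀ a b, L (a * b) = MvPolynomial.C a * L b + MvPolynomial.C b * L a := by
    intro a b
    simp only [L, LinearMap.coe_mk, AddHom.coe_mk, Derivation.leibniz, map_add, map_smul,
      Pi.add_apply, Pi.smul_apply, smul_eq_mul, map_mul, add_mul, Finset.sum_add_distrib,
      Finset.mul_sum, mul_assoc]
  have hLV : ∀ a, L a ∈ V := by
    intro a
    refine Ideal.sum_mem _ fun i _ => Ideal.mul_mem_left _ _ ?_
    exact Ideal.subset_span ⟨i, rfl⟩
  let g1 : R →ₐ[A] MvPolynomial ι R ⧸ V ^ 2 :=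
    AlgHom.ofLinearMap ((Ideal.Quotient.mkₐ A (V ^ 2)).toLinearMap.comp
      ((IsScalarTower.toAlgHom A R (MvPolynomial ι R)).toLinearMap + L))
      (by
        have : L 1 = 0 := by simp [L]
        simp [this])
      (by
        intro a b
        simp only [LinearMap.comp_apply, LinearMap.add_apply, AlgHom.toLinearMap_apply,
          Ideal.Quotient.mkₐ_eq_mk, hLmul, IsScalarTower.coe_toAlgHom']
        rw [← map_mul, Ideal.Quotient.eq]
        have : -(L a * L b) ∈ V ^ 2 := by
          rw [pow_two]; exact neg_mem (Ideal.mul_mem_mul (hLV a) (hLV b))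
        convert this using 1
        rw [map_mul, MvPolynomial.algebraMap_eq]
        ring)
  have hle : V ^ n ≤ V ^ 2 := Ideal.pow_le_pow_right hn
  let ρ : (MvPolynomial ι R ⧸ V ^ n) →ₐ[A] (MvPolynomial ι R ⧸ V ^ 2) :=
    Ideal.Quotient.factorₐ A hle
  have hρ : Function.Surjective ρ := Ideal.Quotient.factor_surjective hle
  have hnil : IsNilpotent (RingHom.ker (ρ : (MvPolynomial ι R ⧸ V ^ n) →+* MvPolynomial ι R ⧸ V ^ 2)) := by
    refine ⟨n, ?_⟩
    rw [Ideal.zero_eq_bot, eq_bot_iff]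
    have h1 : RingHom.ker (ρ : (MvPolynomial ι R ⧸ V ^ n) →+* MvPolynomial ι R ⧸ V ^ 2) ≤
        V.map (Ideal.Quotient.mk (V ^ n)) := by
      intro x hx
      obtain ⟨y, rfl⟩ := Ideal.Quotient.mk_surjective x
      have : Ideal.Quotient.mk (V ^ 2) y = 0 := hx
      rw [Ideal.Quotient.eq_zero_iff_mem] at this
      exact Ideal.mem_map_of_mem _ (Ideal.pow_le_self two_ne_zero this)
    refine (Ideal.pow_right_mono h1 n).trans ?_
    rw [← Ideal.map_pow, Ideal.map_quotient_self]
  refine ⟨Algebra.FormallySmooth.liftOfSurjective g1 ρ hρ hnil, fun r => ?_⟩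
  obtain ⟨P, hP⟩ := Ideal.Quotient.mk_surjective
    (Algebra.FormallySmooth.liftOfSurjective g1 ρ hρ hnil r)
  refine ⟨P, hP, ?_⟩
  have h2 := Algebra.FormallySmooth.liftOfSurjective_apply g1 ρ hρ hnil r
  rw [← hP] at h2
  have h3 : Ideal.Quotient.mk (V ^ 2) P = Ideal.Quotient.mk (V ^ 2)
    (MvPolynomial.C r + ∑ i, MvPolynomial.C (s (KaehlerDifferential.D A R r) i) *
          MvPolynomial.X i) := h2
  exact Ideal.Quotient.eq.mp h3

/-- Transport of the approximate algebra map to `T/m^n`. -/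
lemma exists_h {A R k : Type*} [CommRing A] [CommRing R] [Algebra A R] [CommRing k]
    [Algebra A k] [Algebra R k] [IsScalarTower A R k] (t : Finset R)
    (s : Ω[R⁄A] →ₗ[R] (t → R))
    (hs : ∀ w, w = ∑ i, s w i • KaehlerDifferential.D A R (i : R)) (n : ℕ)
    (g : R →ₐ[A] MvPolynomial t R ⧸ (idealOfVars t R) ^ n)
    (hg : ∀ r, ∃ P : MvPolynomial t R, Ideal.Quotient.mk _ P = g r ∧
        P - (MvPolynomial.C r + ∑ i, MvPolynomial.C (s (KaehlerDifferential.D A R r) i) *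
          MvPolynomial.X i) ∈ (idealOfVars t R) ^ 2)
    (m : Ideal (k ⊗[A] R))
    (hm : ∀ r : R, (1 : k) ⊗ₜ[A] r - algebraMap R k r ⊗ₜ[A] (1 : R) ∈ m) :
    ∃ h : (MvPolynomial t R ⧸ (idealOfVars t R) ^ n) →ₐ[R] (k ⊗[A] R) ⧸ m ^ n,
      ∀ r, h (g r) - Ideal.Quotient.mk (m ^ n) ((1 : k) ⊗ₜ[A] r) ∈
        (m.map (Ideal.Quotient.mk (m ^ n))) ^ 2 := by
  classical
  set V := idealOfVars t R with hV
  let y : R → k ⊗[A] R := fun r => (1 : k) ⊗ₜ[A] r - algebraMap R k r ⊗ₜ[A] (1 : R)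
  let H : MvPolynomial t R →ₐ[R] k ⊗[A] R := MvPolynomial.aeval fun i => y i
  have hH : V ≤ m.comap H := by
    rw [hV, idealOfVars, Ideal.span_le]
    rintro _ ⟨i, rfl⟩
    simp only [SetLike.mem_coe, Ideal.mem_comap, H, MvPolynomial.aeval_X]
    exact hm i
  have hHn : ∀ j, ∀ P ∈ V ^ j, H P ∈ m ^ j := by
    intro j P hP
    have := Ideal.pow_right_mono hH j hP
    exact Ideal.le_comap_pow _ _ this
  let h : (MvPolynomial t R ⧸ V ^ n) →ₐ[R] (k ⊗[A] R) ⧸ m ^ n :=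
    Ideal.Quotient.liftₐ (V ^ n) ((Ideal.Quotient.mkₐ R (m ^ n)).comp H) (by
      intro P hP
      exact Ideal.Quotient.eq_zero_iff_mem.mpr (hHn n P hP))
  have hh : ∀ P, h (Ideal.Quotient.mk _ P) = Ideal.Quotient.mk (m ^ n) (H P) := fun P => rfl
  have hlin : ∀ r : R, y r - ∑ i : t, s (KaehlerDifferential.D A R r) i • y i ∈ m ^ 2 := by
    let d : Derivation A R ((k ⊗[A] R) ⧸ m ^ 2) := Derivation.mk'
      { toFun := fun r => Ideal.Quotient.mk (m ^ 2) (y r)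
        map_add' := by
          intro a b
          rw [← map_add]
          congr 1
          simp only [y, TensorProduct.tmul_add, map_add, TensorProduct.add_tmul]
          ring
        map_smul' := by
          intro a b
          have : y (a • b) = a • y b := by
            simp only [y, smul_sub, TensorProduct.tmul_smul, TensorProduct.smul_tmul']
            rw [← algebraMap_smul R a b, smul_eq_mul, map_mul, ← Algebra.smul_def,
              algebraMap_smul]
          rw [this]
          rfl }
      (by
        intro a b
        simp only [LinearMap.coe_mk, AddHom.coe_mk]
        have h1 : ∀ (c : R) (z : k ⊗[A] R), c • Ideal.Quotient.mk (m ^ 2) z =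
          Ideal.Quotient.mk (m ^ 2) (c • z) := fun c z => rfl
        rw [h1, h1, ← map_add, Ideal.Quotient.eq]
        have h2 : y a * y b ∈ m ^ 2 := by
          rw [pow_two]; exact Ideal.mul_mem_mul (hm a) (hm b)
        convert h2 using 1
        have hA : ∀ c, algebraMap R (k ⊗[A] R) c = algebraMap R k c ⊗ₜ[A] (1 : R) := fun _ => rfl
        simp only [y, Algebra.smul_def, hA, mul_one, map_mul, sub_mul, mul_sub, Algebra.TensorProduct.tmul_mul_tmul, one_mul]
        rw [mul_comm (algebraMap R k b)]
        ring)
    intro r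
    have h1 := congrArg d.liftKaehlerDifferential (hs (KaehlerDifferential.D A R r))
    rw [map_sum] at h1
    simp only [map_smul, Derivation.liftKaehlerDifferential_comp_D] at h1
    rw [← Ideal.Quotient.eq_zero_iff_mem, map_sub, map_sum, sub_eq_zero]
    exact h1
  refine ⟨h, fun r => ?_⟩
  obtain ⟨P, hP, hP2⟩ := hg r
  rw [← hP, hh, ← map_sub, ← Ideal.map_pow]
  apply Ideal.mem_map_of_mem
  have h3 := hHn 2 _ hP2
  have h4 := Ideal.sub_mem _ h3 (hlin r)
  convert h4 using 1
  simp only [map_sub, map_add, map_sum, map_mul, H, MvPolynomial.aeval_X, MvPolynomial.aeval_C,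
    ← Algebra.smul_def]
  have : algebraMap R (k ⊗[A] R) r = algebraMap R k r ⊗ₜ[A] (1 : R) := rfl
  rw [this]
  simp only [y]
  ring

end NoetherianOps

namespace NoetherianOps

open scoped TensorProduct
open MvPolynomial (idealOfVars)

lemma flat_right (A R k : Type*) [CommRing A] [CommRing R] [Field k] [Algebra A R] [Algebra A k]
    [IsDomain A] (hinj : Function.Injective (algebraMap A k)) :
    (Algebra.TensorProduct.includeRight : R →ₐ[A] k ⊗[A] R).toRingHom.Flat := by
  have : FaithfulSMul A k := (faithfulSMul_iff_algebraMap_injective A k).mpr hinj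
  letI := FractionRing.liftAlgebra A k
  have : IsScalarTower A (FractionRing A) k := FractionRing.isScalarTower_liftAlgebra A k
  have : Module.Flat A (FractionRing A) := IsLocalization.flat _ (nonZeroDivisors A)
  have : Module.Flat A k := Module.Flat.trans A (FractionRing A) k
  have h1 : Module.Flat R (R ⊗[A] k) := inferInstance
  have h2 : (algebraMap R (R ⊗[A] k)).Flat := RingHom.flat_algebraMap_iff.mpr h1
  have h4 : ((Algebra.TensorProduct.comm A R k : R ⊗[A] k ≃ₐ[A] k ⊗[A] R) :
      R ⊗[A] k →+* k ⊗[A] R).Flat :=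
    RingHom.Flat.of_bijective (Algebra.TensorProduct.comm A R k).bijective
  have h3 := RingHom.Flat.comp h2 h4
  have he : ((Algebra.TensorProduct.comm A R k : R ⊗[A] k ≃ₐ[A] k ⊗[A] R) :
      R ⊗[A] k →+* k ⊗[A] R).comp (algebraMap R (R ⊗[A] k)) =
      (Algebra.TensorProduct.includeRight : R →ₐ[A] k ⊗[A] R).toRingHom :=
    RingHom.ext fun r => rfl
  rw [← he]
  exact h3

lemma tensor_separation {A R k : Type*} [CommRing A] [CommRing R] [Field k] [Algebra A R]
    [Algebra A k] [IsDomain A] [IsNoetherianRing R] [Algebra.EssFiniteType A R]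
    (hinj : Function.Injective (algebraMap A k))
    (p : Ideal R) [p.IsPrime]
    (I : Ideal R) (hIp : I.IsPrimary) (hrad : I.radical = p) (m : Ideal (k ⊗[A] R))
    (hm : m.IsMaximal) (hmp : ∀ r : R, (1 : k) ⊗ₜ[A] r ∈ m ↔ r ∈ p) :
    ∃ N : ℕ, ∀ n, N ≤ n → ∀ f : R, (1 : k) ⊗ₜ[A] f ∈
      I.map (Algebra.TensorProduct.includeRight : R →ₐ[A] k ⊗[A] R).toRingHom ⊔ m ^ n → f ∈ I := by
  have hnoeth : IsNoetherianRing (k ⊗[A] R) := Algebra.EssFiniteType.isNoetherianRing k _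
  have hflat := flat_right A R k hinj
  let ir := (Algebra.TensorProduct.includeRight : R →ₐ[A] k ⊗[A] R).toRingHom
  have key : ∀ (alg : Algebra R (k ⊗[A] R)) (_ : @algebraMap _ _ _ _ alg = ir)
      (_ : @Module.Flat R (k ⊗[A] R) _ _ alg.toModule),
      ∃ N : ℕ, ∀ n, N ≤ n → ∀ f : R, ir f ∈ I.map ir ⊔ m ^ n → f ∈ I := by
    intro alg halg hfl
    have := @flat_separation R (k ⊗[A] R) _ _ _ hnoeth alg hfl p _ I hIp hrad m hm (by
      ext r
      rw [Ideal.mem_comap, halg]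
      exact hmp r)
    rw [halg] at this
    exact this
  exact key ir.toAlgebra rfl hflat

end NoetherianOps

namespace NoetherianOps

open MvPolynomial (idealOfVars)

/-- **Noetherian operators in `Diff_{R/A}(R, R)` for primary ideals in the formally smooth
case** (Corollary 3.12(i)).  Let `A` be a Noetherian integral domain and `R ⊇ A` a Noetherian
ring which is a formally smooth `A`-algebra, essentially of finite type over `A`.  Let `p` be
a prime of `R` with `p ∩ A = 0`.  Then every `p`-primary ideal `I` of `R` is
`{f ∈ R ∣ δ f ∈ p for all δ ∈ E}` for some `(R ⊗[A] R)`-submodule `E ⊆ Diff_{R/A}(R, R)`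
which is finitely generated for the left (post-composition) `R`-module structure. -/
theorem primary_ideal_eq_sol_formallySmooth
    (A R : Type u) [CommRing A] [CommRing R] [IsDomain A]
    [IsNoetherianRing A] [IsNoetherianRing R] [Algebra A R]
    (hAR : Function.Injective (algebraMap A R))
    [Algebra.FormallySmooth A R] [Algebra.EssFiniteType A R]
    (p : Ideal R) [p.IsPrime]
    (hpA : ∀ a : A, algebraMap A R a ∈ p → a = 0)
    (I : Ideal R) (hIp : I.IsPrimary) (hrad : I.radical = p) :
    ∃ E : Set (R →ₗ[A] R),
      E ⊆ Diff A R R R ∧ IsTensorSubmodule A R R R E ∧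
      (I : Set R) = {f : R | ∀ δ ∈ E, δ f ∈ p} ∧ IsFGLeft R E := by
  classical
  let k := p.ResidueField
  have hkp : ∀ r : R, algebraMap R k r = 0 ↔ r ∈ p := fun r =>
    Ideal.algebraMap_residueField_eq_zero
  have hinj : Function.Injective (algebraMap A k) := by
    rw [injective_iff_map_eq_zero]
    intro a ha
    rw [IsScalarTower.algebraMap_apply A R k, hkp] at ha
    exact hpA a ha
  have hk : ∀ x : k, ∃ c : R, c ∉ p ∧ ∃ r : R, c • x = algebraMap R k r := by
    intro x
    obtain ⟨a, b, hb, hab⟩ := IsFractionRing.div_surjective (R ⧸ p) x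
    obtain ⟨a, rfl⟩ := Ideal.Quotient.mk_surjective a
    obtain ⟨b, rfl⟩ := Ideal.Quotient.mk_surjective b
    have hbp : b ∉ p := fun h => nonZeroDivisors.ne_zero hb (Ideal.Quotient.eq_zero_iff_mem.mpr h)
    refine ⟨b, hbp, a, ?_⟩
    have hb0 : algebraMap R k b ≠ 0 := fun h => hbp ((hkp b).mp h)
    have hab' : algebraMap R k a / algebraMap R k b = x := hab
    rw [← hab', Algebra.smul_def]
    exact mul_div_cancel₀ _ hb0
  let π : k ⊗[A] R →ₐ[k] k := Algebra.TensorProduct.lift (AlgHom.id k k)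
    (IsScalarTower.toAlgHom A R k) (fun _ _ => Commute.all _ _)
  have hπ : ∀ (c : k) (r : R), π (c ⊗ₜ r) = c * algebraMap R k r := fun c r => by
    simp [π]
  let m : Ideal (k ⊗[A] R) := RingHom.ker π
  have hm : m.IsMaximal := RingHom.ker_isMaximal_of_surjective π (fun c => ⟨c ⊗ₜ 1, by simp [hπ]⟩)
  obtain ⟨N, hN⟩ := tensor_separation (k := k) hinj p I hIp hrad m hm (by
    intro r
    rw [RingHom.mem_ker, hπ, one_mul, hkp])
  obtain ⟨t, s, hs⟩ := exists_kaehler_section A R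
  let n := N + 2
  obtain ⟨g, hg⟩ := exists_g s n (by omega)
  obtain ⟨h, hh⟩ := exists_h (k := k) t s hs n g hg m (by
    intro r
    rw [RingHom.mem_ker, map_sub, hπ, hπ]
    simp)
  obtain ⟨hfin, hfree⟩ := truncated_free R t n
  let F := MvPolynomial t R ⧸ (idealOfVars t R) ^ n
  let Λ : (F →ₗ[R] R) →ₗ[R] (R →ₗ[A] R) :=
    { toFun := fun l => (l.restrictScalars A).comp g.toLinearMap
      map_add' := fun _ _ => rfl
      map_smul' := fun _ _ => rfl }
  have hΛ : ∀ l x, Λ l x = l (g x) := fun _ _ => rfl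
  let K : Submodule R (F →ₗ[R] R) :=
    { carrier := {l | ∀ x ∈ I, l (g x) ∈ p}
      zero_mem' := fun x _ => p.zero_mem
      add_mem' := fun ha hb x hx => p.add_mem (ha x hx) (hb x hx)
      smul_mem' := fun c l hl x hx => p.mul_mem_left c (hl x hx) }
  have hKfg : (K.map Λ).FG := (IsNoetherian.noetherian K).map Λ
  refine ⟨K.map Λ, ?_, ⟨?_, ?_, ?_, ?_, ?_⟩, ?_, ?_⟩
  · rintro _ ⟨l, -, rfl⟩
    refine ⟨N + 1, comp_mem_DiffLE ((idealOfVars t R).map (Ideal.Quotient.mk _)) g ?_ (N + 1) l ?_⟩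
    · intro r
      obtain ⟨P, hP, hP2⟩ := hg r
      have h0 : algebraMap R F r = Ideal.Quotient.mk _ (MvPolynomial.C r) := rfl
      rw [← hP, h0, ← map_sub]
      apply Ideal.mem_map_of_mem
      have h1 := Ideal.pow_le_self two_ne_zero hP2
      have h2 : ∑ i : t, MvPolynomial.C (s (KaehlerDifferential.D A R r) i) *
          MvPolynomial.X i ∈ idealOfVars t R :=
        Ideal.sum_mem _ fun i _ => Ideal.mul_mem_left _ _ (Ideal.subset_span ⟨i, rfl⟩)
      have := Ideal.add_mem _ h1 h2
      convert this using 1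
      ring
    · intro x hx
      rw [← Ideal.map_pow] at hx
      have : x = 0 := by
        have h3 := hx
        rw [show N + 1 + 1 = n from rfl, Ideal.map_quotient_self] at h3
        exact h3
      rw [this, map_zero]
  · exact Submodule.zero_mem _
  · exact fun δ hδ ε hε => Submodule.add_mem _ hδ hε
  · exact fun δ hδ => Submodule.neg_mem _ hδ
  · exact fun r δ hδ => Submodule.smul_mem _ r hδ
  · rintro r _ ⟨l, hl, rfl⟩
    refine ⟨l.comp (LinearMap.mulLeft R (g r)), ?_, ?_⟩
    · intro x hx
      have := hl (r * x) (I.mul_mem_left r hx)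
      rw [map_mul] at this
      exact this
    · ext x
      simp [hΛ]
  · apply Set.Subset.antisymm
    · rintro f hf _ ⟨l, hl, rfl⟩
      exact hl f hf
    · intro f hf
      have hf' : ∀ l ∈ K, l (g f) ∈ p := fun l hl => hf (Λ l) ⟨l, hl, rfl⟩
      let V : Submodule k (k ⊗[R] F) := Submodule.span k {v | ∃ x ∈ I, v = (1 : k) ⊗ₜ[R] g x}
      by_cases hV : (1 : k) ⊗ₜ[R] g f ∈ V
      · let φ : k ⊗[A] R →ₐ[k] (k ⊗[A] R) ⧸ m ^ n :=
          Algebra.TensorProduct.lift (Algebra.ofId k _) ((h.restrictScalars A).comp g)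
            (fun _ _ => Commute.all _ _)
        have hφ : ∀ (c : k) (r : R), φ (c ⊗ₜ r) = c • h (g r) := fun c r => by
          simp [φ, Algebra.smul_def, Algebra.ofId_apply]
        have hφm : ∀ x, φ x - Ideal.Quotient.mk (m ^ n) x ∈
            (m.map (Ideal.Quotient.mk (m ^ n))) ^ 2 := by
          intro x
          induction x with
          | zero => simp
          | tmul c r =>
            have h1 : Ideal.Quotient.mk (m ^ n) (c ⊗ₜ[A] r) =
                c • Ideal.Quotient.mk (m ^ n) ((1 : k) ⊗ₜ[A] r) := by
              have : c ⊗ₜ[A] r = c • ((1 : k) ⊗ₜ[A] r) := by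
                rw [TensorProduct.smul_tmul', smul_eq_mul, mul_one]
              rw [this]
              rfl
            rw [hφ, h1, ← smul_sub, Algebra.smul_def]
            exact Ideal.mul_mem_left _ _ (hh r)
          | add x y hx hy =>
            have := Ideal.add_mem _ hx hy
            convert this using 1
            rw [map_add, map_add]
            ring
        let hl : k ⊗[R] F →ₗ[k] (k ⊗[A] R) ⧸ m ^ n := h.toLinearMap.liftBaseChange k
        have hhl : ∀ x : F, hl ((1 : k) ⊗ₜ[R] x) = h x := fun x => by
          simp [hl]
        have hclaim : ∀ v ∈ V, ∃ w ∈
            I.map (Algebra.TensorProduct.includeRight : R →ₐ[A] k ⊗[A] R).toRingHom,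
            φ w = hl v := by
          intro v hv
          induction hv using Submodule.span_induction with
          | mem v hv =>
            obtain ⟨x, hx, rfl⟩ := hv
            refine ⟨(1 : k) ⊗ₜ[A] x, Ideal.mem_map_of_mem _ hx, ?_⟩
            rw [hφ, hhl, one_smul]
          | zero => exact ⟨0, Ideal.zero_mem _, by simp⟩
          | add v w _ _ hv hw =>
            obtain ⟨a, ha, ha'⟩ := hv
            obtain ⟨b, hb, hb'⟩ := hw
            exact ⟨a + b, Ideal.add_mem _ ha hb, by rw [map_add, map_add, ha', hb']⟩
          | smul c v _ hv =>
            obtain ⟨a, ha, ha'⟩ := hv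
            refine ⟨c • a, ?_, by rw [map_smul, map_smul, ha']⟩
            rw [Algebra.smul_def]
            exact Ideal.mul_mem_left _ _ ha
        obtain ⟨w, hw, hw'⟩ := hclaim _ hV
        have hker := ker_le_pow m n φ.toRingHom hφm ((1 : k) ⊗ₜ[A] f - w) (by
          change φ _ = 0
          rw [map_sub, hw', hφ, hhl, one_smul, sub_self])
        refine hN n (by omega) f ?_
        have := Ideal.add_mem _ (Ideal.mem_sup_right (S := I.map
          (Algebra.TensorProduct.includeRight : R →ₐ[A] k ⊗[A] R).toRingHom) hker)
          (Ideal.mem_sup_left (T := m ^ n) hw)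
        simpa using this
      · exfalso
        obtain ⟨μ, hμ, hμV⟩ := Submodule.exists_le_ker_of_notMem hV
        obtain ⟨l, c, hc, hl⟩ := clear_denoms (F := F) p hk
          ((μ.restrictScalars R).comp (TensorProduct.mk R k F 1))
        have hl' : ∀ x : F, algebraMap R k (l x) = c • μ ((1 : k) ⊗ₜ[R] x) := hl
        have hlK : l ∈ K := by
          intro x hx
          rw [← hkp, hl']
          have : μ ((1 : k) ⊗ₜ[R] g x) = 0 := hμV (Submodule.subset_span ⟨x, hx, rfl⟩)
          rw [this, smul_zero]
        have h5 := hf' l hlK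
        rw [← hkp, hl', Algebra.smul_def, mul_eq_zero, hkp] at h5
        exact h5.elim hc hμ
  · obtain ⟨S, hS⟩ := hKfg
    refine ⟨S, ?_, ?_⟩
    · rw [← hS]
      exact Submodule.subset_span
    · intro δ hδ
      rw [← hS] at hδ
      obtain ⟨c, -, hc⟩ := Submodule.mem_span_finset.mp hδ
      exact ⟨c, hc.symm⟩

end NoetherianOps
end

section
/- Let A be a Noetherian integral domain with field of fractions Quot(A) and R a Noetherian commutative ring containing A as a subring, such that R is a formally smooth A-algebra and essentially of finite type over A. Let p be a prime ideal of R with p ∩ A = 0 such that Quot(A) ↪ k(p) = R_p/pR_p is a separable field extension (which holds whenever Quot(A) is perfect). Then for every p-primary ideal I of R with p^{n+1} ⊆ I there exists an (R ⊗_A R)-submodule E ⊆ Diff^n_{R/A}(R, R) such that I = {f ∈ R | δ(f) ∈ p for all δ ∈ E}. -/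
set_option linter.unusedSectionVars false

open scoped TensorProduct

namespace NoetherianOps

lemma formallySmooth_of_sep (k : Type u) (K : Type v) [Field k] [Field K] [Algebra k K]
    [Algebra.EssFiniteType k K] (h : IsSeparableFieldExtension k K) :
    Algebra.FormallySmooth k K := by
  classical
  obtain _ | ⟨p, hp, hpk⟩ := CharP.exists' k
  · infer_instance
  have : ExpChar k p := .prime hp.out
  have : CharP K p := .of_ringHom_of_ne_zero (algebraMap k K) p hp.out.ne_zero
  have hred := h (AlgebraicClosure k)
  have : CharP (K ⊗[k] AlgebraicClosure k) p :=
    .of_ringHom_of_ne_zero (algebraMap k (K ⊗[k] AlgebraicClosure k)) p hp.out.ne_zero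
  have : ExpChar (K ⊗[k] AlgebraicClosure k) p := .prime hp.out
  obtain ⟨s, hs, H⟩ :=
    exists_isTranscendenceBasis_and_isSeparable_of_linearIndepOn_pow_of_essFiniteType
      (k := k) (K := K) p hp.out (fun s hs ↦ by
    rw [linearIndepOn_finset_iff]
    intro c hc i hi
    have hroot : ∀ x : AlgebraicClosure k, ∃ z, z ^ p = x :=
      fun x ↦ IsAlgClosed.exists_pow_nat_eq x hp.out.pos
    choose d hd using fun j ↦ hroot (algebraMap k _ (c j))
    have hz : ∑ j ∈ s, (j ⊗ₜ[k] d j : K ⊗[k] AlgebraicClosure k) = 0 := by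
      apply pow_eq_zero_iff (hp.out.ne_zero) |>.mp
      rw [sum_pow_char]
      simp_rw [Algebra.TensorProduct.tmul_pow, hd, Algebra.algebraMap_eq_smul_one,
        ← TensorProduct.smul_tmul]
      rw [← TensorProduct.sum_tmul, hc, TensorProduct.zero_tmul]
    have hli : LinearIndependent k ((↑) : s → K) := hs
    obtain ⟨l, hl⟩ := LinearMap.exists_extend
      ((Finsupp.lapply (R := k) (⟨i, hi⟩ : s)).comp hli.repr)
    have hl' : ∀ j : s, l j = if j = ⟨i, hi⟩ then 1 else 0 := by
      intro j
      have hj : (j : K) ∈ Submodule.span k (Set.range ((↑) : s → K)) :=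
        Submodule.subset_span ⟨j, rfl⟩
      have h1 := LinearMap.congr_fun hl ⟨j, hj⟩
      have h2 : hli.repr ⟨j, hj⟩ = Finsupp.single j 1 :=
        hli.repr_eq_single j _ rfl
      simp only [LinearMap.comp_apply, Submodule.subtype_apply, h2,
        Finsupp.lapply_apply, Finsupp.single_apply] at h1
      exact h1
    have h3 := congrArg (fun x ↦ TensorProduct.lid k (AlgebraicClosure k)
      (LinearMap.rTensor (AlgebraicClosure k) l x)) hz
    simp only [map_sum, LinearMap.rTensor_tmul, TensorProduct.lid_tmul, map_zero] at h3
    rw [← Finset.sum_coe_sort] at h3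
    simp only [hl', ite_smul, one_smul, zero_smul, Finset.sum_ite_eq', Finset.mem_univ,
      if_true] at h3
    have h4 := hd i
    rw [h3, zero_pow hp.out.ne_zero] at h4
    exact (map_eq_zero _).mp h4.symm)
  have : Algebra.IsSeparable (↥(IntermediateField.adjoin k (Set.range ((↑) : s → K)))) K := by
    convert! H <;> simp
  exact .of_algebraicIndependent_of_isSeparable hs.1

lemma isUnit_of_unipotent {R P : Type*} [CommRing R] [CommRing P] [Algebra R P] (D : Ideal P)
    (n : ℕ) (hD : D ^ (n + 1) = ⊥) (θ : P →ₐ[R] P) (h0 : ∀ x, θ x - x ∈ D)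
    (h1 : ∀ x ∈ D, θ x - x ∈ D ^ 2) : IsUnit (θ.toLinearMap : Module.End R P) := by
  have hθD : ∀ x ∈ D, θ x ∈ D := fun x hx ↦ by
    have := D.add_mem (h0 x) hx
    simpa using this
  have key : ∀ k : ℕ, ∀ x ∈ D ^ k, θ x - x ∈ D ^ (k + 1) := by
    intro k
    induction k with
    | zero => intro x _; simpa using h0 x
    | succ k ih =>
      intro x hx
      rw [pow_succ] at hx
      refine Submodule.mul_induction_on hx ?_ ?_
      · intro a ha b hb
        have e : θ (a * b) - a * b = (θ a - a) * θ b + a * (θ b - b) := by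
          rw [map_mul]; ring
        rw [e]
        refine Ideal.add_mem _ ?_ ?_
        · rw [pow_succ]; exact Ideal.mul_mem_mul (ih a ha) (hθD b hb)
        · have : D ^ (k + 1 + 1) = D ^ k * D ^ 2 := by ring
          rw [this]; exact Ideal.mul_mem_mul ha (h1 b hb)
      · intro a b ha hb
        have e : θ (a + b) - (a + b) = (θ a - a) + (θ b - b) := by
          rw [map_add]; ring
        rw [e]; exact Ideal.add_mem _ ha hb
  have hnil : IsNilpotent ((θ.toLinearMap : Module.End R P) - 1) := by
    refine ⟨n + 1, ?_⟩
    have : ∀ k : ℕ, ∀ x, (((θ.toLinearMap : Module.End R P) - 1) ^ k) x ∈ D ^ k := by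
      intro k
      induction k with
      | zero => intro x; simp
      | succ k ih =>
        intro x
        rw [pow_succ' (_ - _), Module.End.mul_apply]
        exact key k _ (ih x)
    ext x
    have := this (n + 1) x
    rw [hD] at this
    simpa using this
  have := hnil.isUnit_one_add
  simpa using this

lemma exists_lift_functional {R K : Type*} [CommRing R] (p : Ideal R) [p.IsPrime]
    [Field K] [Algebra (R ⧸ p) K] [IsFractionRing (R ⧸ p) K]
    [Algebra R K] [IsScalarTower R (R ⧸ p) K] (m n : ℕ)
    (g : MvPolynomial (Fin m) R →ₗ[R] K)
    (hg : ∀ q ∈ MvPolynomial.idealOfVars (Fin m) R ^ (n + 1), g q = 0) :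
    ∃ (s : R) (ψ : MvPolynomial (Fin m) R →ₗ[R] R), s ∉ p ∧
      (∀ q ∈ MvPolynomial.idealOfVars (Fin m) R ^ (n + 1), ψ q = 0) ∧
      ∀ q, algebraMap R K (ψ q) = algebraMap R K s * g q := by
  classical
  have hfin : {a : Fin m →₀ ℕ | a.degree ≤ n}.Finite := Finsupp.finite_of_degree_le n
  obtain ⟨⟨b, hb⟩, hb'⟩ := IsLocalization.exist_integer_multiples_of_finset
    (nonZeroDivisors (R ⧸ p)) (hfin.toFinset.image fun a ↦ g (MvPolynomial.monomial a 1))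
  obtain ⟨s, rfl⟩ := Ideal.Quotient.mk_surjective b
  have hs : s ∉ p := by
    intro h
    exact nonZeroDivisors.ne_zero hb (Ideal.Quotient.eq_zero_iff_mem.mpr h)
  have hex : ∀ a : Fin m →₀ ℕ, ∃ r : R, (¬ a.degree ≤ n → r = 0) ∧
      algebraMap R K r = algebraMap R K s * g (MvPolynomial.monomial a 1) := by
    intro a
    by_cases ha : a.degree ≤ n
    · obtain ⟨c, hc⟩ := hb' _ (Finset.mem_image_of_mem _ (hfin.mem_toFinset.mpr ha))
      obtain ⟨r, rfl⟩ := Ideal.Quotient.mk_surjective c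
      refine ⟨r, fun h ↦ (h ha).elim, ?_⟩
      rw [IsScalarTower.algebraMap_apply R (R ⧸ p) K, IsScalarTower.algebraMap_apply R (R ⧸ p) K]
      simpa [Algebra.smul_def] using hc
    · refine ⟨0, fun _ ↦ rfl, ?_⟩
      rw [hg, mul_zero, map_zero]
      rw [MvPolynomial.mem_pow_idealOfVars_iff']
      intro x hx
      rw [MvPolynomial.coeff_monomial, if_neg]
      rintro rfl
      omega
  choose r hr0 hr using hex
  let ψ : MvPolynomial (Fin m) R →ₗ[R] R := (MvPolynomial.basisMonomials (Fin m) R).constr R r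
  have hψ : ∀ a, ψ (MvPolynomial.monomial a 1) = r a := by
    intro a
    have := (MvPolynomial.basisMonomials (Fin m) R).constr_basis R r a
    simpa using this
  refine ⟨s, ψ, hs, ?_, ?_⟩
  · intro q hq
    rw [MvPolynomial.mem_pow_idealOfVars_iff] at hq
    rw [q.as_sum, map_sum]
    refine Finset.sum_eq_zero fun a ha ↦ ?_
    have : MvPolynomial.monomial a (q.coeff a) = q.coeff a • MvPolynomial.monomial a (1 : R) := by
      simp [MvPolynomial.smul_monomial]
    rw [this, map_smul, hψ, hr0 a (by have := hq a ha; omega), smul_zero]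
  · intro q
    have : (Algebra.linearMap R K).comp ψ = s • g := by
      refine (MvPolynomial.basisMonomials (Fin m) R).ext fun a ↦ ?_
      simp [hψ, hr, Algebra.smul_def]
    simpa [Algebra.smul_def] using LinearMap.congr_fun this q

lemma exists_functional (A R : Type*) [CommRing A] [CommRing R] [Algebra A R]
    (p : Ideal R) [p.IsPrime] (K : Type*) [Field K] [Algebra (R ⧸ p) K] [IsFractionRing (R ⧸ p) K]
    [Algebra R K] [IsScalarTower R (R ⧸ p) K] [Algebra A K] [IsScalarTower A R K]
    [Algebra.FormallySmooth A K]
    (n : ℕ) (I : Ideal R) (hIp : I.IsPrimary) (hrad : I.radical = p)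
    (hpnI : p ^ (n + 1) ≤ I) (f : R) (hf : f ∉ I) :
    ∃ δ : R ⊗[A] R →ₗ[R] K, (∀ x ∈ KaehlerDifferential.ideal A R ^ (n + 1), δ x = 0) ∧
      (∀ i ∈ I, δ (1 ⊗ₜ i) = 0) ∧ δ (1 ⊗ₜ f) ≠ 0 := by
  have hker : ∀ r : R, algebraMap R K r = 0 ↔ r ∈ p := by
    intro r
    rw [IsScalarTower.algebraMap_apply R (R ⧸ p) K,
      map_eq_zero_iff _ (IsFractionRing.injective (R ⧸ p) K)]
    exact Ideal.Quotient.eq_zero_iff_mem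
  let L := Localization.AtPrime p
  let J : Ideal L := I.map (algebraMap R L)
  have hIp' : I ≤ p := hrad ▸ Ideal.le_radical
  have hu : ∀ y : p.primeCompl, IsUnit (Algebra.ofId R K (y : R)) := by
    intro y
    refine isUnit_iff_ne_zero.mpr fun h ↦ y.2 ((hker _).mp h)
  let π₀ : L →ₐ[R] K := IsLocalization.liftAlgHom (M := p.primeCompl) (f := Algebra.ofId R K) hu
  let π₁ : L ⧸ J →ₐ[R] K := Ideal.Quotient.liftₐ J π₀ (by
    change J ≤ RingHom.ker π₀
    rw [Ideal.map_le_iff_le_comap]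
    intro x hx
    rw [Ideal.mem_comap, RingHom.mem_ker, AlgHom.commutes]
    exact (hker x).mpr (hIp' hx))
  let π : L ⧸ J →ₐ[A] K := π₁.restrictScalars A
  have hπ0 : ∀ x, π (Ideal.Quotient.mk J x) = π₀ x := fun x ↦ rfl
  have hπR : ∀ r : R, π (algebraMap R (L ⧸ J) r) = algebraMap R K r := fun r ↦ π₁.commutes r
  have hsurj : Function.Surjective π := by
    intro k
    obtain ⟨a, b, hb, rfl⟩ := IsFractionRing.div_surjective (A := R ⧸ p) k
    obtain ⟨a, rfl⟩ := Ideal.Quotient.mk_surjective a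
    obtain ⟨b, rfl⟩ := Ideal.Quotient.mk_surjective b
    have hbp : b ∈ p.primeCompl := fun h ↦
      nonZeroDivisors.ne_zero hb (Ideal.Quotient.eq_zero_iff_mem.mpr h)
    refine ⟨Ideal.Quotient.mk J (IsLocalization.mk' L a ⟨b, hbp⟩), ?_⟩
    have e := congrArg π₀ (IsLocalization.mk'_spec L a ⟨b, hbp⟩)
    rw [map_mul, AlgHom.commutes, AlgHom.commutes] at e
    have hb1 : ∀ x : R, algebraMap (R ⧸ p) K (Ideal.Quotient.mk p x) = algebraMap R K x :=
      fun x ↦ (IsScalarTower.algebraMap_apply R (R ⧸ p) K x).symm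
    rw [hπ0, hb1, hb1, eq_div_iff]
    · exact e
    · intro h
      exact hbp ((hker b).mp h)
  have hkerle : RingHom.ker π ≤ p.map (algebraMap R (L ⧸ J)) := by
    intro x hx
    obtain ⟨x, rfl⟩ := Ideal.Quotient.mk_surjective x
    obtain ⟨a, b, rfl⟩ := IsLocalization.exists_mk'_eq p.primeCompl x
    have hx' : π₀ (IsLocalization.mk' L a b) = 0 := hx
    have e := congrArg π₀ (IsLocalization.mk'_spec L a b)
    rw [map_mul, AlgHom.commutes, AlgHom.commutes, hx', zero_mul] at e
    have ha := (hker a).mp e.symm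
    rw [IsLocalization.mk'_eq_mul_mk'_one, map_mul]
    exact Ideal.mul_mem_right _ _ (Ideal.mem_map_of_mem (algebraMap R (L ⧸ J)) ha)
  have hmapI : I.map (algebraMap R (L ⧸ J)) = ⊥ := by
    rw [eq_bot_iff, Ideal.map_le_iff_le_comap]
    intro x hx
    change algebraMap R (L ⧸ J) x = 0
    exact Ideal.Quotient.eq_zero_iff_mem.mpr (Ideal.mem_map_of_mem _ hx)
  have hpow : RingHom.ker π ^ (n + 1) = ⊥ := by
    rw [eq_bot_iff]
    calc _ ≤ (p.map (algebraMap R (L ⧸ J))) ^ (n + 1) := Ideal.pow_right_mono hkerle _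
      _ = (p ^ (n + 1)).map (algebraMap R (L ⧸ J)) := (Ideal.map_pow _ _ _).symm
      _ ≤ I.map (algebraMap R (L ⧸ J)) := Ideal.map_mono hpnI
      _ = ⊥ := hmapI
  have hf0 : algebraMap R (L ⧸ J) f ≠ 0 := by
    intro h
    have h1 : algebraMap R L f ∈ J := Ideal.Quotient.eq_zero_iff_mem.mp h
    apply hf
    rw [← IsLocalization.under_map_of_isPrimary_disjoint p.primeCompl L hIp
      (Set.disjoint_left.mpr fun x hx hx' ↦ hx (hIp' hx'))]
    exact h1
  let σ : K →ₐ[A] L ⧸ J :=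
    Algebra.FormallySmooth.liftOfSurjective (AlgHom.id A K) π hsurj ⟨n + 1, hpow⟩
  have hσ : ∀ k, π (σ k) = k := fun k ↦
    Algebra.FormallySmooth.liftOfSurjective_apply (AlgHom.id A K) π hsurj ⟨n + 1, hpow⟩ k
  let _ : Module K (L ⧸ J) := Module.compHom (L ⧸ J) σ.toRingHom
  obtain ⟨φ, hφ⟩ : ∃ φ : Module.Dual K (L ⧸ J), φ (algebraMap R (L ⧸ J) f) ≠ 0 := by
    by_contra! h
    exact hf0 ((Module.forall_dual_apply_eq_zero_iff K _).mp h)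
  have hφσ : ∀ k b, φ (σ k * b) = k * φ b := fun k b ↦ φ.map_smul k b
  let μ : R ⊗[A] R →ₐ[A] L ⧸ J := Algebra.TensorProduct.productMap
    (σ.comp (IsScalarTower.toAlgHom A R K)) (IsScalarTower.toAlgHom A R (L ⧸ J))
  have hμ : ∀ a b, μ (a ⊗ₜ b) = σ (algebraMap R K a) * algebraMap R (L ⧸ J) b := fun a b ↦
    Algebra.TensorProduct.productMap_apply_tmul _ _ _ _
  have hμπ : π.comp μ = (IsScalarTower.toAlgHom A R K).comp (Algebra.TensorProduct.lmul' A) := by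
    ext a
    · simp [hμ, hσ]
    · simp [hμ, hπR]
  have hμΔ : KaehlerDifferential.ideal A R ≤ (RingHom.ker π).comap μ := by
    intro x hx
    have hx' : Algebra.TensorProduct.lmul' A x = 0 := hx
    have := AlgHom.congr_fun hμπ x
    rw [AlgHom.comp_apply, AlgHom.comp_apply, hx', map_zero] at this
    exact this
  let δ : R ⊗[A] R →ₗ[R] K :=
    { toFun := fun x ↦ φ (μ x)
      map_add' := fun x y ↦ by rw [map_add, map_add]
      map_smul' := fun r x ↦ by
        have : r • x = (r ⊗ₜ[A] (1 : R)) * x := by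
          rw [Algebra.smul_def]; rfl
        rw [this, map_mul, hμ, map_one, mul_one, hφσ, RingHom.id_apply, Algebra.smul_def] }
  have hδ1 : ∀ r, δ (1 ⊗ₜ r) = φ (algebraMap R (L ⧸ J) r) := by
    intro r
    change φ (μ (1 ⊗ₜ r)) = _
    rw [hμ, map_one, map_one, one_mul]
  refine ⟨δ, ?_, ?_, ?_⟩
  · intro x hx
    have h1 : μ x ∈ RingHom.ker π ^ (n + 1) := by
      have := Ideal.pow_right_mono hμΔ (n + 1) hx
      exact Ideal.le_comap_pow μ (n + 1) this
    rw [hpow] at h1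
    change φ (μ x) = 0
    rw [show μ x = 0 from h1, map_zero]
  · intro i hi
    rw [hδ1]
    have : algebraMap R (L ⧸ J) i ∈ I.map (algebraMap R (L ⧸ J)) := Ideal.mem_map_of_mem _ hi
    rw [hmapI] at this
    rw [show algebraMap R (L ⧸ J) i = 0 from this, map_zero]
  · rw [hδ1]; exact hφ

lemma exists_coords (A R : Type*) [CommRing A] [CommRing R] [Algebra A R]
    [Algebra.FormallySmooth A R] [Algebra.EssFiniteType A R] :
    ∃ (m : ℕ) (y : Fin m → R ⊗[A] R) (c : Fin m → Derivation A R R),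
      (∀ i, y i ∈ KaehlerDifferential.ideal A R) ∧
      ∀ r, (1 : R) ⊗ₜ[A] r - r ⊗ₜ[A] (1 : R) - ∑ i, (c i r) • y i ∈
        KaehlerDifferential.ideal A R ^ 2 := by
  obtain ⟨m, φ, hφ⟩ := Module.Finite.exists_fin' R (Ω[R⁄A])
  obtain ⟨l, hl⟩ := Module.projective_lifting_property φ LinearMap.id hφ
  choose y hy using fun i : Fin m ↦
    (KaehlerDifferential.ideal A R).toCotangent_surjective (φ (Pi.single i 1))
  refine ⟨m, fun i ↦ (y i : R ⊗[A] R),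
    fun i ↦ ((LinearMap.proj i).comp l).compDer (KaehlerDifferential.D A R),
    fun i ↦ (y i).2, fun r ↦ ?_⟩
  have h1 : KaehlerDifferential.D A R r =
      ∑ i, (l (KaehlerDifferential.D A R r) i) • φ (Pi.single i 1) := by
    have := LinearMap.congr_fun hl (KaehlerDifferential.D A R r)
    rw [LinearMap.comp_apply, LinearMap.id_apply] at this
    conv_lhs => rw [← this, pi_eq_sum_univ' (l (KaehlerDifferential.D A R r)), map_sum]
    refine Finset.sum_congr rfl fun i _ ↦ ?_
    rw [← map_smul]
  let z : KaehlerDifferential.ideal A R :=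
    ⟨_, KaehlerDifferential.one_smul_sub_smul_one_mem_ideal A r⟩ -
      ∑ i, (l (KaehlerDifferential.D A R r) i) • y i
  have hz : (KaehlerDifferential.ideal A R).toCotangent z = 0 := by
    rw [map_sub, map_sum, sub_eq_zero]
    have h2 : (KaehlerDifferential.ideal A R).toCotangent
      ⟨_, KaehlerDifferential.one_smul_sub_smul_one_mem_ideal A r⟩ =
        KaehlerDifferential.D A R r := rfl
    rw [h2, h1]
    refine Finset.sum_congr rfl fun i _ ↦ ?_
    rw [← h1, ← hy]
    have h3 : ∀ (a : R) (w : KaehlerDifferential.ideal A R), a • w = algebraMap R (R ⊗[A] R) a • w :=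
      fun a w ↦ (algebraMap_smul _ a w).symm
    rw [h3, map_smul]
    exact (algebraMap_smul (R ⊗[A] R) _ _).symm
  have := (Ideal.toCotangent_eq_zero _ z).mp hz
  simpa [z] using this

open MvPolynomial in
lemma exists_taylor (A R : Type*) [CommRing A] [CommRing R] [Algebra A R]
    [Algebra.FormallySmooth A R] [Algebra.EssFiniteType A R] (n : ℕ) :
    ∃ (m : ℕ) (y : Fin m → R ⊗[A] R)
      (β : R →ₐ[A] MvPolynomial (Fin m) R ⧸ idealOfVars (Fin m) R ^ (n + 1)),
      (∀ i, y i ∈ KaehlerDifferential.ideal A R) ∧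
      ∀ r, ∃ q, β r = Ideal.Quotient.mk _ q ∧ q - C r ∈ idealOfVars (Fin m) R ∧
        aeval y q - (1 : R) ⊗ₜ[A] r ∈ KaehlerDifferential.ideal A R ^ 2 := by
  obtain ⟨m, y, c, hy, hc⟩ := exists_coords A R
  let V := idealOfVars (Fin m) R
  have hX : ∀ i, (X i : MvPolynomial (Fin m) R) ∈ V := fun i ↦ Ideal.subset_span ⟨i, rfl⟩
  let B := MvPolynomial (Fin m) R ⧸ V ^ (n + 1)
  let J : Ideal B := (V ^ 2).map (Ideal.Quotient.mk (V ^ (n + 1)))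
  let τ : R → MvPolynomial (Fin m) R := fun r ↦ C r + ∑ i, C (c i r) * X i
  let g' : MvPolynomial (Fin m) R →ₐ[A] B ⧸ J :=
    (Ideal.Quotient.mkₐ A J).comp (Ideal.Quotient.mkₐ A (V ^ (n + 1)))
  have hg' : ∀ q ∈ V ^ 2, g' q = 0 := fun q hq ↦
    Ideal.Quotient.eq_zero_iff_mem.mpr (Ideal.mem_map_of_mem _ hq)
  have hsum : ∀ r, ∑ i, C (c i r) * X i ∈ V := fun r ↦
    Ideal.sum_mem _ fun i _ ↦ Ideal.mul_mem_left _ _ (hX i)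
  let τl : R →ₗ[A] MvPolynomial (Fin m) R :=
    { toFun := τ
      map_add' := fun a b ↦ by
        simp only [τ, map_add, add_mul, Finset.sum_add_distrib]; ring
      map_smul' := fun a b ↦ by
        have hC : ∀ x : R, (C (a • x) : MvPolynomial (Fin m) R) = a • C x :=
          fun x ↦ by
            simp only [← MvPolynomial.monomial_zero', MvPolynomial.smul_monomial]
        simp only [τ, Derivation.map_smul, hC, RingHom.id_apply, smul_add, Finset.smul_sum,
          smul_mul_assoc] }
  let g : R →ₐ[A] B ⧸ J := AlgHom.ofLinearMap (g'.toLinearMap.comp τl)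
    (by
      change g' (τ 1) = 1
      simp [τ])
    (by
      intro a b
      change g' (τ (a * b)) = g' (τ a) * g' (τ b)
      rw [← map_mul, ← sub_eq_zero, ← map_sub]
      apply hg'
      have e : τ (a * b) - τ a * τ b =
          - ((∑ i, C (c i a) * X i) * (∑ i, C (c i b) * X i)) := by
        have : ∑ i, C (c i (a * b)) * X i =
            C a * (∑ i, C (c i b) * X i) + C b * (∑ i, C (c i a) * X i) := by
          rw [Finset.mul_sum, Finset.mul_sum, ← Finset.sum_add_distrib]
          refine Finset.sum_congr rfl fun i _ ↦ ?_
          rw [Derivation.leibniz]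
          simp only [smul_eq_mul, map_add, map_mul]
          ring
        simp only [τ, this, map_mul]
        ring
      rw [e, pow_two]
      exact neg_mem (Ideal.mul_mem_mul (hsum a) (hsum b)))
  have hJ : IsNilpotent J := by
    refine ⟨n + 1, ?_⟩
    rw [← Ideal.map_pow, ← pow_mul, mul_comm, pow_mul, pow_two, Ideal.map_mul,
      Ideal.map_quotient_self]
    simp
  let β := Algebra.FormallySmooth.lift J hJ g
  have hβ : ∀ r, Ideal.Quotient.mk J (β r) = g r := Algebra.FormallySmooth.mk_lift J hJ g
  refine ⟨m, y, β, hy, fun r ↦ ?_⟩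
  have h1 : β r - Ideal.Quotient.mk (V ^ (n + 1)) (τ r) ∈ J := by
    rw [← Ideal.Quotient.eq, hβ]
    rfl
  rw [Ideal.mem_map_iff_of_surjective _ Ideal.Quotient.mk_surjective] at h1
  obtain ⟨q, hq, hq'⟩ := h1
  have hVΔ : V ≤ (KaehlerDifferential.ideal A R).comap (aeval y : _ →ₐ[R] R ⊗[A] R) := by
    rw [Ideal.span_le]
    rintro _ ⟨i, rfl⟩
    simpa using hy i
  refine ⟨τ r + q, ?_, ?_, ?_⟩
  · rw [map_add, hq']; ring
  · have : τ r + q - C r = (∑ i, C (c i r) * X i) + q := by simp only [τ]; ring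
    rw [this]
    exact add_mem (hsum r) (Ideal.pow_le_self two_ne_zero hq)
  · have h2 : aeval y q ∈ KaehlerDifferential.ideal A R ^ 2 :=
      Ideal.le_comap_pow _ 2 (Ideal.pow_right_mono hVΔ 2 hq)
    have h3 : aeval y (τ r + q) - (1 : R) ⊗ₜ[A] r = aeval y q -
      ((1 : R) ⊗ₜ[A] r - r ⊗ₜ[A] (1 : R) - ∑ i, (c i r) • y i) := by
      have : algebraMap R (R ⊗[A] R) r = r ⊗ₜ 1 := rfl
      simp only [τ, map_add, map_sum, map_mul, aeval_X, aeval_C, this, Algebra.smul_def]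
      ring
    rw [h3]
    exact sub_mem h2 (hc r)


lemma mem_DiffLE_of_nilpotent {A R B : Type*} [CommRing A] [CommRing R] [Algebra A R]
    [CommRing B] [Algebra A B] [Algebra R B] [IsScalarTower A R B] (β : R →ₐ[A] B)
    (V : Ideal B) (n : ℕ) (hV : V ^ (n + 1) = ⊥) (hβ : ∀ r, β r - algebraMap R B r ∈ V)
    (ψ : B →ₗ[R] R) :
    ∀ (k j : ℕ), j + k = n → ∀ b ∈ V ^ j, ∀ δ : R →ₗ[A] R, (∀ x, δ x = ψ (b * β x)) →
      δ ∈ DiffLE A R R R k := by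
  have hbr : ∀ (b : B) (δ : R →ₗ[A] R), (∀ x, δ x = ψ (b * β x)) → ∀ r x,
      opBracket A R R R r δ x = ψ ((b * (β r - algebraMap R B r)) * β x) := by
    intro b δ hδ r x
    rw [opBracket_apply, hδ, hδ, ← map_smul, ← map_sub, smul_eq_mul, map_mul, Algebra.smul_def]
    congr 1
    ring
  intro k
  induction k with
  | zero =>
    intro j hj b hb δ hδ r
    ext
    rw [hbr b δ hδ]
    have : b * (β r - algebraMap R B r) ∈ V ^ (n + 1) := by
      obtain rfl : j = n := by omega
      rw [pow_succ]; exact Ideal.mul_mem_mul hb (hβ r)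
    rw [hV] at this
    rw [show b * (β r - algebraMap R B r) = 0 from this]
    simp
  | succ k ih =>
    intro j hj b hb δ hδ r
    refine ih (j + 1) (by omega) (b * (β r - algebraMap R B r)) ?_ _ (hbr b δ hδ r)
    rw [pow_succ]; exact Ideal.mul_mem_mul hb (hβ r)

open MvPolynomial in
/-- Lifting of functionals on principal parts to differential operators, up to a scalar. -/
lemma exists_lift_diffOp (A R : Type*) [CommRing A] [CommRing R] [Algebra A R]
    [Algebra.FormallySmooth A R] [Algebra.EssFiniteType A R]
    (p : Ideal R) [p.IsPrime] (K : Type*) [Field K] [Algebra (R ⧸ p) K] [IsFractionRing (R ⧸ p) K]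
    [Algebra R K] [IsScalarTower R (R ⧸ p) K] (n : ℕ)
    (δ : R ⊗[A] R →ₗ[R] K)
    (hδ : ∀ x ∈ KaehlerDifferential.ideal A R ^ (n + 1), δ x = 0) :
    ∃ (s : R) (D : R →ₗ[A] R), s ∉ p ∧ D ∈ DiffLE A R R R n ∧
      ∀ r, algebraMap R K (D r) = algebraMap R K s * δ (1 ⊗ₜ r) := by
  obtain ⟨m, y, β, hy, hβ⟩ := exists_taylor A R n
  let Δ := KaehlerDifferential.ideal A R
  let V := idealOfVars (Fin m) R
  let P := (R ⊗[A] R) ⧸ Δ ^ (n + 1)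
  let mkP : R ⊗[A] R →ₐ[R] P := Ideal.Quotient.mkₐ R (Δ ^ (n + 1))
  have hmkP : Function.Surjective mkP := Ideal.Quotient.mk_surjective
  let T := MvPolynomial (Fin m) R ⧸ V ^ (n + 1)
  have hVΔ : V ≤ Δ.comap (aeval y : _ →ₐ[R] R ⊗[A] R) := by
    rw [Ideal.span_le]
    rintro _ ⟨i, rfl⟩
    change aeval y (X i) ∈ KaehlerDifferential.ideal A R
    rw [aeval_X]
    exact hy i
  let α : T →ₐ[R] P := Ideal.Quotient.liftₐ (V ^ (n + 1)) (mkP.comp (aeval y)) (by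
    intro q hq
    exact Ideal.Quotient.eq_zero_iff_mem.mpr
      (Ideal.le_comap_pow _ (n + 1) (Ideal.pow_right_mono hVΔ (n + 1) hq)))
  have hα : ∀ q, α (Ideal.Quotient.mk _ q) = mkP (aeval y q) := fun q ↦ rfl
  let E : Ideal P := Δ.map mkP
  have hE : E ^ (n + 1) = ⊥ := by
    change (Δ.map (Ideal.Quotient.mk (Δ ^ (n + 1)))) ^ (n + 1) = ⊥
    rw [← Ideal.map_pow, Ideal.map_quotient_self]
  let θ₀ : R ⊗[A] R →ₐ[R] P := Algebra.TensorProduct.lift (Algebra.ofId R P)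
    ((α.restrictScalars A).comp β) (fun _ _ ↦ Commute.all _ _)
  have hθ1 : ∀ r, θ₀ (1 ⊗ₜ r) = α (β r) := fun r ↦ by
    simp [θ₀]
  have hθ2 : ∀ r, θ₀ (1 ⊗ₜ r) - mkP (1 ⊗ₜ r) ∈ E ^ 2 := fun r ↦ by
    obtain ⟨q, hq, -, hq'⟩ := hβ r
    rw [hθ1, hq, hα, ← map_sub, ← Ideal.map_pow]
    exact Ideal.mem_map_of_mem _ hq'
  have hθ3 : ∀ x, θ₀ x - mkP x ∈ E ^ 2 := fun x ↦ by
    induction x with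
    | zero => simp
    | add a b ha hb =>
      have : θ₀ (a + b) - mkP (a + b) = (θ₀ a - mkP a) + (θ₀ b - mkP b) := by
        rw [map_add, map_add]; ring
      rw [this]; exact add_mem ha hb
    | tmul a b =>
      have h1 : a ⊗ₜ[A] b = a • ((1 : R) ⊗ₜ[A] b) := by
        rw [TensorProduct.smul_tmul', smul_eq_mul, mul_one]
      rw [h1, map_smul, map_smul, ← smul_sub, Algebra.smul_def]
      exact Ideal.mul_mem_left _ _ (hθ2 b)
  have hE2 : E ^ 2 ≤ E := Ideal.pow_le_self two_ne_zero
  have hθΔ : Δ ≤ E.comap θ₀ := fun x hx ↦ by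
    have := add_mem (hE2 (hθ3 x)) (Ideal.mem_map_of_mem mkP hx)
    simpa using this
  let θ : P →ₐ[R] P := Ideal.Quotient.liftₐ (Δ ^ (n + 1)) θ₀ (by
    intro x hx
    have : θ₀ x ∈ E ^ (n + 1) :=
      Ideal.le_comap_pow _ (n + 1) (Ideal.pow_right_mono hθΔ (n + 1) hx)
    rw [hE] at this
    exact this)
  have hθ : ∀ x, θ (mkP x) = θ₀ x := fun x ↦ rfl
  have hθ4 : ∀ x, θ x - x ∈ E ^ 2 := fun x ↦ by
    obtain ⟨x, rfl⟩ := hmkP x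
    exact hθ3 x
  obtain ⟨u, hu⟩ := isUnit_of_unipotent E n hE θ (fun x ↦ hE2 (hθ4 x)) (fun x _ ↦ hθ4 x)
  let δP : P →ₗ[R] K := Submodule.liftQ ((Δ ^ (n + 1)).restrictScalars R) δ
    (fun x hx ↦ hδ x hx)
  have hδP : ∀ x, δP (mkP x) = δ x := fun x ↦ rfl
  let ε : P →ₗ[R] K := δP.comp ((u⁻¹ : (Module.End R P)ˣ) : Module.End R P)
  have hε : ∀ x, ε (θ x) = δP x := fun x ↦ by
    have h1 : (u : Module.End R P) x = θ x := by rw [hu]; rfl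
    change δP (((u⁻¹ : (Module.End R P)ˣ) : Module.End R P) (θ x)) = _
    rw [← h1, ← Module.End.mul_apply, Units.inv_mul, Module.End.one_apply]
  obtain ⟨s, ψ, hs, hψ0, hψ⟩ := exists_lift_functional p m n
    ((ε.comp α.toLinearMap).comp (Ideal.Quotient.mkₐ R (V ^ (n + 1))).toLinearMap)
    (fun q hq ↦ by
      have : (Ideal.Quotient.mk (V ^ (n + 1))) q = 0 := Ideal.Quotient.eq_zero_iff_mem.mpr hq
      simp only [LinearMap.comp_apply, AlgHom.toLinearMap_apply, Ideal.Quotient.mkₐ_eq_mk, this,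
        map_zero])
  let ψT : T →ₗ[R] R := Submodule.liftQ ((V ^ (n + 1)).restrictScalars R) ψ
    (fun x hx ↦ hψ0 x hx)
  have hψT : ∀ t, algebraMap R K (ψT t) = algebraMap R K s * ε (α t) := fun t ↦ by
    obtain ⟨q, rfl⟩ := Ideal.Quotient.mk_surjective t
    exact hψ q
  let D : R →ₗ[A] R := (ψT.restrictScalars A).comp β.toLinearMap
  refine ⟨s, D, hs, ?_, fun r ↦ ?_⟩
  · refine mem_DiffLE_of_nilpotent β (V.map (Ideal.Quotient.mk (V ^ (n + 1)))) n ?_ ?_ ψT n 0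
      (by omega) 1 (by simp) D (fun x ↦ by rw [one_mul]; rfl)
    · rw [← Ideal.map_pow, Ideal.map_quotient_self]
    · intro r
      obtain ⟨q, hq, hq', -⟩ := hβ r
      have : algebraMap R T r = Ideal.Quotient.mk (V ^ (n + 1)) (C r) := rfl
      rw [hq, this, ← map_sub]
      exact Ideal.mem_map_of_mem _ hq'
  · change algebraMap R K (ψT (β r)) = _
    rw [hψT, ← hθ1, ← hθ, hε, hδP]

lemma DiffLE_closed (A R : Type*) [CommRing A] [CommRing R] [Algebra A R] (n : ℕ) :
    IsTensorSubmodule A R R R (DiffLE A R R R n) := by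
  induction n with
  | zero =>
    refine ⟨fun r ↦ ?_, fun δ hδ ε hε r ↦ ?_, fun δ hδ r ↦ ?_, fun s δ hδ r ↦ ?_,
      fun s δ hδ r ↦ ?_⟩
    · ext; simp
    · ext x
      have h1 := LinearMap.congr_fun (hδ r) x
      have h2 := LinearMap.congr_fun (hε r) x
      simp only [opBracket_apply, LinearMap.zero_apply, LinearMap.add_apply, smul_eq_mul] at *
      linear_combination h1 + h2
    · ext x
      have h1 := LinearMap.congr_fun (hδ r) x
      simp only [opBracket_apply, LinearMap.zero_apply, LinearMap.neg_apply, smul_eq_mul] at *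
      linear_combination -h1
    · ext x
      have h1 := LinearMap.congr_fun (hδ r) x
      simp only [opBracket_apply, LinearMap.zero_apply, LinearMap.smul_apply, smul_eq_mul] at *
      linear_combination s * h1
    · ext x
      have h1 := LinearMap.congr_fun (hδ r) (s * x)
      simp only [opBracket_apply, LinearMap.zero_apply, preSMul_apply, smul_eq_mul] at *
      rw [mul_left_comm]
      exact h1
  | succ n ih =>
    obtain ⟨i0, ia, ineg, il, ir⟩ := ih
    refine ⟨fun r ↦ ?_, fun δ hδ ε hε r ↦ ?_, fun δ hδ r ↦ ?_, fun s δ hδ r ↦ ?_,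
      fun s δ hδ r ↦ ?_⟩
    · convert i0 using 1
      ext; simp
    · convert ia _ (hδ r) _ (hε r) using 1
      ext; simp only [opBracket_apply, LinearMap.add_apply, smul_eq_mul]; ring
    · convert ineg _ (hδ r) using 1
      ext; simp only [opBracket_apply, LinearMap.neg_apply, smul_eq_mul]; ring
    · convert il s _ (hδ r) using 1
      ext; simp only [opBracket_apply, LinearMap.smul_apply, smul_eq_mul]; ring
    · convert ir s _ (hδ r) using 1
      ext x
      simp only [opBracket_apply, preSMul_apply, smul_eq_mul, mul_left_comm s r]

/-- **Noetherian operators in `Diffⁿ_{R/A}(R, R)` for primary ideals containing `p^{n+1}`,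
formally smooth separable case** (Corollary 3.12(ii)).  If moreover `Quot(A) ↪ k(p)` is a
separable field extension (where `k(p)` is realized as the fraction field `K` of `R/p`),
then every `p`-primary ideal `I ⊇ p^{n+1}` is `{f ∈ R ∣ δ f ∈ p for all δ ∈ E}` for some
`(R ⊗[A] R)`-submodule `E ⊆ Diffⁿ_{R/A}(R, R)`. -/
theorem primary_ideal_eq_sol_formallySmooth_of_le_order
    (A R : Type u) [CommRing A] [CommRing R] [IsDomain A]
    [IsNoetherianRing A] [IsNoetherianRing R] [Algebra A R]
    (hAR : Function.Injective (algebraMap A R))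
    [Algebra.FormallySmooth A R] [Algebra.EssFiniteType A R]
    (p : Ideal R) [p.IsPrime]
    (hpA : ∀ a : A, algebraMap A R a ∈ p → a = 0)
    (FA : Type*) [Field FA] [Algebra A FA] [IsFractionRing A FA]
    (K : Type*) [Field K] [Algebra (R ⧸ p) K] [IsFractionRing (R ⧸ p) K]
    [Algebra R K] [IsScalarTower R (R ⧸ p) K] [Algebra A K] [IsScalarTower A R K]
    [Algebra FA K] [IsScalarTower A FA K]
    (hsep : IsSeparableFieldExtension FA K)
    (n : ℕ) (I : Ideal R) (hIp : I.IsPrimary) (hrad : I.radical = p)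
    (hpnI : p ^ (n + 1) ≤ I) :
    ∃ E : Set (R →ₗ[A] R),
      E ⊆ DiffLE A R R R n ∧ IsTensorSubmodule A R R R E ∧
      (I : Set R) = {f : R | ∀ δ ∈ E, δ f ∈ p} := by
  have : Algebra.EssFiniteType R K := by
    have : Algebra.EssFiniteType (R ⧸ p) K :=
      Algebra.EssFiniteType.of_isLocalization K (nonZeroDivisors (R ⧸ p))
    exact Algebra.EssFiniteType.comp R (R ⧸ p) K
  have : Algebra.EssFiniteType A K := Algebra.EssFiniteType.comp A R K
  have : Algebra.EssFiniteType FA K := Algebra.EssFiniteType.of_comp A FA K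
  have : Algebra.FormallySmooth FA K := formallySmooth_of_sep FA K hsep
  have : Algebra.FormallySmooth A FA := .of_isLocalization (nonZeroDivisors A)
  have : Algebra.FormallySmooth A K := .comp A FA K
  have hker : ∀ r : R, algebraMap R K r = 0 ↔ r ∈ p := by
    intro r
    rw [IsScalarTower.algebraMap_apply R (R ⧸ p) K,
      map_eq_zero_iff _ (IsFractionRing.injective (R ⧸ p) K)]
    exact Ideal.Quotient.eq_zero_iff_mem
  obtain ⟨i0, ia, ineg, il, ir⟩ := DiffLE_closed A R n
  refine ⟨{δ | δ ∈ DiffLE A R R R n ∧ ∀ f ∈ I, δ f ∈ p}, fun δ hδ ↦ hδ.1,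
    ⟨⟨i0, fun f _ ↦ p.zero_mem⟩,
      fun δ hδ ε hε ↦ ⟨ia _ hδ.1 _ hε.1, fun f hf ↦ p.add_mem (hδ.2 f hf) (hε.2 f hf)⟩,
      fun δ hδ ↦ ⟨ineg _ hδ.1, fun f hf ↦ p.neg_mem (hδ.2 f hf)⟩,
      fun r δ hδ ↦ ⟨il r _ hδ.1, fun f hf ↦ p.mul_mem_left r (hδ.2 f hf)⟩,
      fun r δ hδ ↦ ⟨ir r _ hδ.1, fun f hf ↦ hδ.2 _ (I.mul_mem_left r hf)⟩⟩, ?_⟩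
  ext f
  refine ⟨fun hf δ hδ ↦ hδ.2 f hf, fun h ↦ ?_⟩
  by_contra hf
  obtain ⟨δ, hδ, hδI, hδf⟩ := exists_functional A R p K n I hIp hrad hpnI f hf
  obtain ⟨s, D, hs, hD, hDδ⟩ := exists_lift_diffOp A R p K n δ hδ
  have h1 := h D ⟨hD, fun i hi ↦ by rw [← hker, hDδ, hδI i hi, mul_zero]⟩
  rw [← hker, hDδ] at h1
  exact mul_ne_zero (fun h ↦ hs ((hker s).mp h)) hδf h1

end NoetherianOps
end

section
/- Let R be a Noetherian commutative ring and A ⊆ R a subring which is a Noetherian integral domain, with field of fractions Quot(A). Let p be a prime ideal of R with p ∩ A = 0, write k(p) = R_p/pR_p (an R-module via R → R_p → k(p)), and suppose the ring k(p) ⊗_{Quot(A)} R_p is Noetherian. Let M be a finitely generated R-module. Then for every p-primary R-submodule U of M there exists an (R ⊗_A R)-submodule E ⊆ Diff_{R/A}(M, k(p)) such that U = Sol(E), and E is finitely generated as an R_p-module via the left (post-composition) module structure. -/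
set_option linter.unusedSectionVars false

open scoped TensorProduct

namespace NoetherianOps


/-- A finite module over a Noetherian local ring killed by a power of the maximal ideal
is Artinian. -/
lemma isArtinian_of_pow_smul {S V : Type*} [CommRing S] [IsLocalRing S] [IsNoetherianRing S]
    [AddCommGroup V] [Module S V] [Module.Finite S V] (N : ℕ)
    (hN : ∀ s ∈ IsLocalRing.maximalIdeal S ^ N, ∀ v : V, s • v = 0) : IsArtinian S V := by
  rcases subsingleton_or_nontrivial V with hV | hV
  · infer_instance
  set J : Ideal S := IsLocalRing.maximalIdeal S ^ N with hJ
  have hJne : J ≠ ⊤ := by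
    intro h
    obtain ⟨v, hv⟩ := exists_ne (0 : V)
    apply hv
    have := hN 1 (by rw [h]; trivial) v
    simpa using this
  have : Nontrivial (S ⧸ J) := Ideal.Quotient.nontrivial_iff.mpr hJne
  have : IsLocalRing (S ⧸ J) := IsLocalRing.of_surjective' (Ideal.Quotient.mk J)
    Ideal.Quotient.mk_surjective
  have : IsArtinianRing (S ⧸ J) := by
    rw [isArtinianRing_iff_isNilpotent_maximalIdeal]
    refine ⟨N, ?_⟩
    have h1 : IsLocalRing.maximalIdeal (S ⧸ J)
        = (IsLocalRing.maximalIdeal S).map (Ideal.Quotient.mk J) := by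
      apply le_antisymm
      · intro x hx
        obtain ⟨s, rfl⟩ := Ideal.Quotient.mk_surjective x
        apply Ideal.mem_map_of_mem
        rw [IsLocalRing.mem_maximalIdeal] at hx ⊢
        exact fun h => hx (h.map _)
      · apply IsLocalRing.le_maximalIdeal
        intro h
        have h2 : ((IsLocalRing.maximalIdeal S).map (Ideal.Quotient.mk J)) ^ N = ⊥ := by
          rw [← Ideal.map_pow, ← hJ, Ideal.map_quotient_self]
        rw [h, Ideal.top_pow] at h2
        exact bot_ne_top h2.symm
    rw [h1, ← Ideal.map_pow, ← hJ, Ideal.map_quotient_self]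
    rfl
  let : Module (S ⧸ J) V := Module.IsTorsionBySet.module (I := J) (fun v s => hN s.1 s.2 v)
  have : IsScalarTower S (S ⧸ J) V := ⟨fun s t v => by
    obtain ⟨t, rfl⟩ := Ideal.Quotient.mk_surjective t
    change (s • t) • v = s • t • v
    rw [smul_assoc]⟩
  have : Module.Finite (S ⧸ J) V := Module.Finite.of_restrictScalars_finite S _ V
  have : IsArtinian (S ⧸ J) V := inferInstance
  exact isArtinian_of_surjective_algebraMap (R := S ⧸ J) Ideal.Quotient.mk_surjective

/-- Separation: the fibres `B ⊗ V` detect `V` modulo a power of the augmentation ideal. -/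
lemma exists_pow_separates {S K B V : Type*} [CommRing S] [IsLocalRing S] [IsNoetherianRing S]
    [Field K] [Algebra S K]
    (hsurj : Function.Surjective (algebraMap S K))
    [CommRing B] [Algebra S B] [Module.Flat S B] [IsNoetherianRing B] (μ : B →ₐ[S] K)
    [AddCommGroup V] [Module S V] [Module.Finite S V] (N : ℕ)
    (hN : ∀ s ∈ IsLocalRing.maximalIdeal S ^ N, ∀ v : V, s • v = 0) :
    ∃ n : ℕ, ∀ v : V, (1 : B) ⊗ₜ[S] v ∈
      ((RingHom.ker μ) ^ n • ⊤ : Submodule B (B ⊗[S] V)) → v = 0 := by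
  have hArt := isArtinian_of_pow_smul N hN
  have hkerS : RingHom.ker (algebraMap S K) = IsLocalRing.maximalIdeal S :=
    IsLocalRing.eq_maximalIdeal (RingHom.ker_isMaximal_of_surjective _ hsurj)
  let F : ℕ → Submodule S V := fun n =>
    (((RingHom.ker μ) ^ n • ⊤ : Submodule B (B ⊗[S] V)).restrictScalars S).comap
      (TensorProduct.mk S B V 1)
  have hF : ∀ n v, v ∈ F n ↔ (1 : B) ⊗ₜ[S] v ∈
      ((RingHom.ker μ) ^ n • ⊤ : Submodule B (B ⊗[S] V)) := fun n v => Iff.rfl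
  have hanti : ∀ {a b}, a ≤ b → F b ≤ F a := by
    intro a b hab v hv
    rw [hF] at hv ⊢
    exact Submodule.smul_mono_left (Ideal.pow_le_pow_right hab) hv
  obtain ⟨n, hn⟩ := IsArtinian.monotone_stabilizes
    (⟨fun n => OrderDual.toDual (F n), fun a b hab => hanti hab⟩ : ℕ →o (Submodule S V)ᵒᵈ)
  have hn' : ∀ m, n ≤ m → F n = F m := fun m hm => OrderDual.toDual.injective (hn m hm)
  refine ⟨n, fun v hv => ?_⟩
  by_contra hv0
  have hvF : v ∈ F n := hv
  have hnt : Nontrivial (F n) := ⟨⟨⟨v, hvF⟩, 0, fun h => hv0 (congrArg Subtype.val h)⟩⟩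
  obtain ⟨q, hq⟩ := associatedPrimes.nonempty S (F n)
  rw [AssociatedPrimes.mem_iff, isAssociatedPrime_iff] at hq
  obtain ⟨hqp, ⟨w, hwF⟩, hqw⟩ := hq
  have hqmem : ∀ s, s ∈ q ↔ s • w = 0 := by
    intro s
    rw [hqw, Submodule.mem_colon_singleton, Submodule.mem_bot, Subtype.ext_iff]
    rfl
  have hmq : IsLocalRing.maximalIdeal S ≤ q := by
    have : IsLocalRing.maximalIdeal S ^ N ≤ q := fun s hs => (hqmem s).2 (hN s hs w)
    exact hqp.le_of_pow_le this
  -- Krull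
  have hinf : (1 : B) ⊗ₜ[S] w ∈
      (⨅ i : ℕ, (RingHom.ker μ) ^ i • ⊤ : Submodule B (B ⊗[S] V)) := by
    rw [Submodule.mem_iInf]
    intro i
    rw [← hF]
    rcases le_total n i with h | h
    · rw [← hn' i h]; exact hwF
    · exact hanti h hwF
  rw [Ideal.mem_iInf_smul_pow_eq_bot_iff] at hinf
  obtain ⟨⟨b, hb⟩, hbw⟩ := hinf
  have hbw : b ⊗ₜ[S] w = (1 : B) ⊗ₜ[S] w := by
    simpa [TensorProduct.smul_tmul'] using hbw
  -- flatness
  have hq : LinearMap.ker (LinearMap.toSpanSingleton S V w) = q := by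
    ext s; rw [hqmem]; simp
  let f : (S ⧸ q) →ₗ[S] V := Submodule.liftQ q (LinearMap.toSpanSingleton S V w) hq.ge
  have hf : Function.Injective f := by
    rw [← LinearMap.ker_eq_bot]
    exact Submodule.ker_liftQ_eq_bot _ _ _ hq.le
  have hfl : Function.Injective (f.lTensor B) :=
    Module.Flat.lTensor_preserves_injective_linearMap f hf
  have hone : b ⊗ₜ[S] (Submodule.Quotient.mk 1 : S ⧸ q) = (1 : B) ⊗ₜ[S] Submodule.Quotient.mk 1 := by
    apply hfl
    have : f (Submodule.Quotient.mk 1) = w := by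
      change (1 : S) • w = w
      exact one_smul _ _
    rw [LinearMap.lTensor_tmul, LinearMap.lTensor_tmul, this, hbw]
  have hqm : q = IsLocalRing.maximalIdeal S :=
    ((IsLocalRing.maximalIdeal.isMaximal S).eq_of_le hqp.ne_top hmq).symm
  let g : (S ⧸ q) →ₗ[S] K := Submodule.liftQ q (Algebra.linearMap S K) (by
    intro s hs
    rw [hqm, ← hkerS] at hs
    exact hs)
  have h3 := congrArg ((LinearMap.mul' S K) ∘ₗ (TensorProduct.map μ.toLinearMap g)) hone
  have hg : g (Submodule.Quotient.mk 1) = 1 := by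
    change algebraMap S K 1 = 1
    exact map_one _
  have hb' : μ b = 0 := hb
  rw [LinearMap.comp_apply, LinearMap.comp_apply, TensorProduct.map_tmul,
    TensorProduct.map_tmul, hg] at h3
  simp [hb'] at h3

/-- Finiteness of the jets. -/
lemma exists_finset_span {K B X : Type*} [Field K] [CommRing B] [Algebra K B]
    [IsNoetherianRing B] (μ : B →ₐ[K] K)
    [AddCommGroup X] [Module B X] [Module K X] [IsScalarTower K B X] [Module.Finite B X] (n : ℕ) :
    ∃ s : Finset X, ∀ x : X, ∃ y ∈ Submodule.span K (s : Set X),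
      x - y ∈ ((RingHom.ker μ) ^ n • ⊤ : Submodule B X) := by
  classical
  induction n with
  | zero => exact ⟨∅, fun x => ⟨0, zero_mem _, by simp⟩⟩
  | succ n ih =>
    obtain ⟨s, hs⟩ := ih
    obtain ⟨t, ht⟩ := (inferInstance : IsNoetherian B X).noetherian
      ((RingHom.ker μ) ^ n • ⊤ : Submodule B X)
    have key : ∀ x ∈ Submodule.span B (t : Set X), ∃ y ∈ Submodule.span K (t : Set X),
        x - y ∈ ((RingHom.ker μ) ^ (n + 1) • ⊤ : Submodule B X) := by
      intro x hx
      induction hx using Submodule.span_induction with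
      | mem x hx => exact ⟨x, Submodule.subset_span hx, by simp⟩
      | zero => exact ⟨0, zero_mem _, by simp⟩
      | add x y _ _ h1 h2 =>
        obtain ⟨a, ha, ha'⟩ := h1
        obtain ⟨b, hb, hb'⟩ := h2
        exact ⟨a + b, add_mem ha hb, by rw [add_sub_add_comm]; exact add_mem ha' hb'⟩
      | smul b x hx h =>
        obtain ⟨y, hy, hy'⟩ := h
        refine ⟨μ b • y, Submodule.smul_mem _ _ hy, ?_⟩
        have h1 : b • x - μ b • y = (b - algebraMap K B (μ b)) • x
            + algebraMap K B (μ b) • (x - y) := by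
          rw [sub_smul, smul_sub, algebraMap_smul, algebraMap_smul]; abel
        rw [h1]
        refine add_mem ?_ (Submodule.smul_mem _ _ hy')
        rw [pow_succ', ← smul_eq_mul, Submodule.smul_assoc]
        refine Submodule.smul_mem_smul ?_ (ht ▸ hx)
        simp [RingHom.mem_ker]
    refine ⟨s ∪ t, fun x => ?_⟩
    obtain ⟨y, hy, hxy⟩ := hs x
    rw [← ht] at hxy
    obtain ⟨z, hz, hxz⟩ := key _ hxy
    refine ⟨y + z, add_mem (Submodule.span_mono (by simp) hy) (Submodule.span_mono (by simp) hz), ?_⟩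
    rwa [← sub_sub]


/-- Functionals on jets give differential operators. -/
lemma mem_diffLE_of_functional {A R K B X M : Type*} [CommRing A] [CommRing R] [Algebra A R]
    [Field K] [CommRing B] [Algebra K B] (μ : B →ₐ[K] K)
    [AddCommGroup X] [Module B X] [Module K X] [IsScalarTower K B X]
    [Algebra R K] [Algebra A K] [IsScalarTower A R K]
    [AddCommGroup M] [Module R M] [Module A M] [IsScalarTower A R M]
    (j : R →+* B) (hj : ∀ r, μ (j r) = algebraMap R K r)
    (ι : M →+ X) (hι : ∀ (r : R) m, ι (r • m) = j r • ι m) (n : ℕ) :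
    ∀ (φ : X →ₗ[K] K), (∀ x ∈ ((RingHom.ker μ) ^ (n + 1) • ⊤ : Submodule B X), φ x = 0) →
      ∀ δ : M →ₗ[A] K, (∀ m, δ m = φ (ι m)) → δ ∈ DiffLE A R M K n := by
  have hmem : ∀ r, j r - algebraMap K B (algebraMap R K r) ∈ RingHom.ker μ := by
    intro r
    simp [RingHom.mem_ker, hj]
  have hbr : ∀ (φ : X →ₗ[K] K) (δ : M →ₗ[A] K), (∀ m, δ m = φ (ι m)) → ∀ r m,
      opBracket A R M K r δ m = φ ((j r - algebraMap K B (algebraMap R K r)) • ι m) := by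
    intro φ δ h r m
    rw [opBracket_apply, h, h, hι, sub_smul, map_sub,
      algebraMap_smul B (algebraMap R K r) (ι m), map_smul φ (algebraMap R K r) (ι m),
      algebraMap_smul K r (φ (ι m))]
  induction n with
  | zero =>
    intro φ hφ δ hδ r
    ext m
    rw [hbr φ δ hδ]
    apply hφ
    rw [zero_add, pow_one]
    exact Submodule.smul_mem_smul (hmem r) trivial
  | succ n ih =>
    intro φ hφ δ hδ r
    let b := j r - algebraMap K B (algebraMap R K r)
    refine ih (φ ∘ₗ ((LinearMap.lsmul B X b).restrictScalars K)) ?_ _ (fun m => ?_)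
    · intro x hx
      change φ (b • x) = 0
      apply hφ
      rw [pow_succ', ← smul_eq_mul, Submodule.smul_assoc]
      exact Submodule.smul_mem_smul (hmem r) hx
    · exact hbr φ δ hδ r m

/-- The main construction: jets give a suitable space of differential operators. -/
lemma exists_ops {A R Rp K B X M : Type*} [CommRing A] [CommRing R] [Algebra A R]
    [Field K] [CommRing Rp] [Algebra Rp K] (hsurj : Function.Surjective (algebraMap Rp K))
    [CommRing B] [IsNoetherianRing B] [Algebra K B] (μ : B →ₐ[K] K)
    [AddCommGroup X] [Module B X] [Module K X] [IsScalarTower K B X] [Module.Finite B X]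
    [Algebra R K] [Algebra A K] [IsScalarTower A R K] [SMulCommClass A Rp K]
    [AddCommGroup M] [Module R M] [Module A M] [IsScalarTower A R M]
    (j : R →+* B) (hj : ∀ r, μ (j r) = algebraMap R K r)
    (hjA : ∀ a, j (algebraMap A R a) = algebraMap K B (algebraMap A K a))
    (ι : M →+ X) (hι : ∀ (r : R) m, ι (r • m) = j r • ι m) (n : ℕ) :
    ∃ E : Set (M →ₗ[A] K),
      E ⊆ Diff A R M K ∧ IsTensorSubmodule A R M K E ∧
      {m | ι m ∈ ((RingHom.ker μ) ^ (n + 1) • ⊤ : Submodule B X)} = Sol E ∧ IsFGLeft Rp E := by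
  let P₀ : Submodule B X := (RingHom.ker μ) ^ (n + 1) • ⊤
  let P : Submodule K X := P₀.restrictScalars K
  have hfin : Module.Finite K (X ⧸ P) := by
    obtain ⟨s, hs⟩ := exists_finset_span μ (X := X) (n + 1)
    classical
    refine ⟨⟨s.image P.mkQ, ?_⟩⟩
    rw [eq_top_iff]
    intro x _
    obtain ⟨x, rfl⟩ := P.mkQ_surjective x
    obtain ⟨y, hy, hxy⟩ := hs x
    have h1 : P.mkQ x = P.mkQ y := (Submodule.Quotient.eq P).2 hxy
    rw [h1, Finset.coe_image, Submodule.span_image]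
    exact Submodule.mem_map_of_mem hy
  let D : Module.Dual K (X ⧸ P) →ₗ[K] (M →ₗ[A] K) :=
    { toFun := fun φ =>
        { toFun := fun m => φ (P.mkQ (ι m))
          map_add' := fun a b => by simp
          map_smul' := fun a m => by
            rw [← algebraMap_smul R a m, hι, hjA, algebraMap_smul, map_smul, map_smul,
              RingHom.id_apply, algebraMap_smul] }
      map_add' := fun φ ψ => by ext m; rfl
      map_smul' := fun c φ => by ext m; rfl }
  have hD : ∀ φ m, D φ m = φ (P.mkQ (ι m)) := fun _ _ => rfl
  refine ⟨(LinearMap.range D : Set (M →ₗ[A] K)), ?_, ⟨?_, ?_, ?_, ?_, ?_⟩, ?_, ?_⟩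
  · rintro _ ⟨φ, rfl⟩
    refine ⟨n, mem_diffLE_of_functional μ j hj ι hι n (φ ∘ₗ P.mkQ) ?_ _ (fun m => rfl)⟩
    intro x hx
    rw [LinearMap.comp_apply, Submodule.mkQ_apply, (Submodule.Quotient.mk_eq_zero P).2 hx, map_zero]
  · exact zero_mem _
  · exact fun _ h _ h' => add_mem h h'
  · exact fun _ h => neg_mem h
  · intro r δ h
    have : r • δ = algebraMap R K r • δ := by ext m; simp [Algebra.smul_def]
    rw [this]
    exact Submodule.smul_mem _ _ h
  · rintro r _ ⟨φ, rfl⟩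
    let L : X →ₗ[K] X := (LinearMap.lsmul B X (j r)).restrictScalars K
    have hL : P ≤ P.comap L := fun x hx => P₀.smul_mem (j r) hx
    refine ⟨φ ∘ₗ P.mapQ P L hL, ?_⟩
    ext m
    rw [preSMul_apply, hD, hD, hι]
    rfl
  · ext m
    constructor
    · rintro hm _ ⟨φ, rfl⟩
      rw [hD, Submodule.mkQ_apply, (Submodule.Quotient.mk_eq_zero P).2 hm, map_zero]
    · intro hm
      change ι m ∈ P
      rw [← Submodule.Quotient.mk_eq_zero P]
      rw [← Module.forall_dual_apply_eq_zero_iff K]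
      exact fun φ => hm (D φ) ⟨φ, rfl⟩
  · have hfg : (LinearMap.range D).FG := Module.Finite.iff_fg.1 inferInstance
    obtain ⟨s, hs⟩ := hfg
    refine ⟨s, fun x hx => ?_, fun δ hδ => ?_⟩
    · rw [← hs]; exact Submodule.subset_span hx
    · have hδ' : δ ∈ LinearMap.range D := hδ
      rw [← hs, Submodule.mem_span_finset] at hδ'
      obtain ⟨c, -, hc⟩ := hδ'
      choose c' hc' using hsurj
      refine ⟨fun g => c' (c g), ?_⟩
      rw [← hc]
      refine Finset.sum_congr rfl fun g _ => ?_
      ext m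
      simp [Algebra.smul_def, hc']

/-- The same without a `K`-structure on `X`: jets give a suitable space of differential operators. -/
lemma exists_ops' {A R Rp K B X M : Type*} [CommRing A] [CommRing R] [Algebra A R]
    [Field K] [CommRing Rp] [Algebra Rp K] (hsurj : Function.Surjective (algebraMap Rp K))
    [CommRing B] [IsNoetherianRing B] [Algebra K B] (μ : B →ₐ[K] K)
    [AddCommGroup X] [Module B X] [Module.Finite B X]
    [Algebra R K] [Algebra A K] [IsScalarTower A R K] [SMulCommClass A Rp K]
    [AddCommGroup M] [Module R M] [Module A M] [IsScalarTower A R M]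
    (j : R →+* B) (hj : ∀ r, μ (j r) = algebraMap R K r)
    (hjA : ∀ a, j (algebraMap A R a) = algebraMap K B (algebraMap A K a))
    (ι : M →+ X) (hι : ∀ (r : R) m, ι (r • m) = j r • ι m) (n : ℕ) :
    ∃ E : Set (M →ₗ[A] K),
      E ⊆ Diff A R M K ∧ IsTensorSubmodule A R M K E ∧
      {m | ι m ∈ ((RingHom.ker μ) ^ (n + 1) • ⊤ : Submodule B X)} = Sol E ∧ IsFGLeft Rp E := by
  let modKX : Module K X := Module.compHom X (algebraMap K B)
  have towKX : IsScalarTower K B X := ⟨fun c b x => by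
    rw [Algebra.smul_def, mul_smul]; rfl⟩
  exact exists_ops hsurj μ j hj hjA ι hι n

/-- If `Ass W = {p}`, a power of `p` kills `W`. -/
lemma exists_pow_smul_eq_zero {R W : Type*} [CommRing R] [IsNoetherianRing R]
    [AddCommGroup W] [Module R W] [Module.Finite R W] (p : Ideal R)
    (h : associatedPrimes R W = {p}) : ∃ N : ℕ, ∀ r ∈ p ^ N, ∀ w : W, r • w = 0 := by
  have h1 : p ≤ (Module.annihilator R W).radical := by
    rw [← Ideal.sInf_minimalPrimes]
    refine le_sInf fun q hq => ?_
    have := Module.associatedPrimes.minimalPrimes_annihilator_subset_associatedPrimes R W hq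
    rw [h] at this
    exact (Set.mem_singleton_iff.1 this).ge
  obtain ⟨N, hN⟩ := Ideal.exists_pow_le_of_le_radical_of_fg h1 (IsNoetherian.noetherian p)
  exact ⟨N, fun r hr w => Module.mem_annihilator.1 (hN hr) w⟩

/-- **Primary submodules as solution sets of differential operators** (Theorem 3.14(i)).
Same setting as Theorem 3.10(i), with `M` a finitely generated `R`-module: every `p`-primary
submodule `U` of `M` (i.e. a proper submodule with `Ass(M/U) = {p}`) is the solution set of
an `(R ⊗[A] R)`-submodule `E ⊆ Diff_{R/A}(M, k(p))` which is finitely generated for the left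
(post-composition) `R_p`-module structure. -/
theorem primary_submodule_eq_sol
    (A R : Type*) [CommRing A] [CommRing R] [IsDomain A]
    [IsNoetherianRing A] [IsNoetherianRing R] [Algebra A R]
    (hAR : Function.Injective (algebraMap A R))
    (p : Ideal R) [p.IsPrime]
    (hpA : ∀ a : A, algebraMap A R a ∈ p → a = 0)
    (FA : Type*) [Field FA] [Algebra A FA] [IsFractionRing A FA]
    (Rp : Type*) [CommRing Rp] [Algebra R Rp] [IsLocalization.AtPrime Rp p]
    [Algebra A Rp] [IsScalarTower A R Rp] [Algebra FA Rp] [IsScalarTower A FA Rp]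
    (K : Type*) [Field K] [Algebra Rp K]
    (hsurj : Function.Surjective (algebraMap Rp K))
    (hker : RingHom.ker (algebraMap Rp K) = p.map (algebraMap R Rp))
    [Algebra R K] [IsScalarTower R Rp K] [Algebra A K] [IsScalarTower A R K]
    [IsScalarTower A Rp K] [Algebra FA K] [IsScalarTower A FA K]
    (hNoeth : IsNoetherianRing (K ⊗[FA] Rp))
    (M : Type*) [AddCommGroup M] [Module R M] [Module A M] [IsScalarTower A R M]
    [Module.Finite R M]
    (U : Submodule R M) (hUne : U ≠ ⊤)
    (hUprim : associatedPrimes R (M ⧸ U) = {p}) :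
    ∃ E : Set (M →ₗ[A] K),
      E ⊆ Diff A R M K ∧ IsTensorSubmodule A R M K E ∧
      (U : Set M) = Sol E ∧ IsFGLeft Rp E := by
  classical
  -- the local ring `Rp`
  have hloc : IsLocalRing Rp := IsLocalization.AtPrime.isLocalRing Rp p
  have hRpN : IsNoetherianRing Rp := IsLocalization.isNoetherianRing p.primeCompl Rp inferInstance
  have hmax : IsLocalRing.maximalIdeal Rp = p.map (algebraMap R Rp) := by
    rw [← hker]
    exact (IsLocalRing.eq_maximalIdeal (RingHom.ker_isMaximal_of_surjective _ hsurj)).symm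
  have hFA : IsScalarTower FA Rp K := by
    apply IsScalarTower.of_algebraMap_eq'
    apply IsLocalization.ringHom_ext (nonZeroDivisors A)
    ext a
    simp only [RingHom.comp_apply]
    rw [← IsScalarTower.algebraMap_apply A FA K, ← IsScalarTower.algebraMap_apply A FA Rp,
      ← IsScalarTower.algebraMap_apply A Rp K]
  -- the ring `B`
  let B := Rp ⊗[FA] K
  have hBN : IsNoetherianRing B :=
    isNoetherianRing_of_ringEquiv (K ⊗[FA] Rp) (Algebra.TensorProduct.comm FA K Rp).toRingEquiv
  let μ₀ : B →ₐ[Rp] K := Algebra.TensorProduct.lift (Algebra.ofId Rp K) (AlgHom.id FA K)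
    (fun _ _ => Commute.all _ _)
  let algKB : Algebra K B := Algebra.TensorProduct.rightAlgebra
  have halg : ∀ c : K, algebraMap K B c = (1 : Rp) ⊗ₜ[FA] c := fun c => rfl
  have hcomm : ∀ c : K, μ₀.toRingHom (algebraMap K B c) = algebraMap K K c := by
    intro c
    change μ₀ ((1 : Rp) ⊗ₜ[FA] c) = c
    refine (Algebra.TensorProduct.lift_tmul _ _ _ _ _).trans ?_
    simp
  let μ : B →ₐ[K] K := { toRingHom := μ₀.toRingHom, commutes' := hcomm }
  -- the modules
  let W := M ⧸ U
  let V := Rp ⊗[R] W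
  obtain ⟨N, hN⟩ := exists_pow_smul_eq_zero (W := W) p hUprim
  have hNV : ∀ s ∈ IsLocalRing.maximalIdeal Rp ^ N, ∀ v : V, s • v = 0 := by
    intro s hs v
    rw [hmax, ← Ideal.map_pow] at hs
    have hle : (p ^ N).map (algebraMap R Rp) ≤ Module.annihilator Rp V := by
      rw [Ideal.map_le_iff_le_comap]
      intro r hr
      rw [Ideal.mem_comap, Module.mem_annihilator]
      intro v
      induction v using TensorProduct.induction_on with
      | zero => simp
      | add x y hx hy => rw [smul_add, hx, hy, add_zero]
      | tmul x w =>
        rw [algebraMap_smul, ← TensorProduct.tmul_smul, hN r hr, TensorProduct.tmul_zero]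
    exact Module.mem_annihilator.1 (hle hs) v
  obtain ⟨n, hn⟩ := exists_pow_separates (S := Rp) (K := K) (B := B) (V := V) hsurj μ₀ N hNV
  have hWV : ∀ w : W, (1 : Rp) ⊗ₜ[R] w = (0 : V) → w = 0 := by
    intro w hw
    have h1 : TensorProduct.mk R Rp W 1 w = 0 := hw
    rw [IsLocalizedModule.eq_zero_iff p.primeCompl] at h1
    obtain ⟨c, hc⟩ := h1
    by_contra hw0
    have h2 : (c : R) ∈ ⋃ q ∈ associatedPrimes R W, (q : Set R) := by
      rw [biUnion_associatedPrimes_eq_zero_divisors]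
      exact ⟨w, hw0, hc⟩
    have h3 : associatedPrimes R W = {p} := hUprim
    rw [h3] at h2
    simp only [Set.mem_singleton_iff, Set.iUnion_iUnion_eq_left, SetLike.mem_coe] at h2
    exact c.2 h2
  let X := B ⊗[Rp] V
  let j : R →+* B := (algebraMap Rp B).comp (algebraMap R Rp)
  let ι : M →+ X :=
    { toFun := fun m => (1 : B) ⊗ₜ[Rp] ((1 : Rp) ⊗ₜ[R] (Submodule.Quotient.mk m : W))
      map_zero' := by simp
      map_add' := fun a b => by simp [TensorProduct.tmul_add] }
  have hιdef : ∀ m, ι m = (1 : B) ⊗ₜ[Rp] ((1 : Rp) ⊗ₜ[R] (Submodule.Quotient.mk m : W)) :=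
    fun _ => rfl
  obtain ⟨E, h1, h2, h3, h4⟩ := exists_ops' (A := A) (R := R) (Rp := Rp) (K := K) (B := B)
    (X := X) (M := M) hsurj μ j
    (fun r => by
      change μ₀ (algebraMap Rp B (algebraMap R Rp r)) = _
      rw [AlgHom.commutes, ← IsScalarTower.algebraMap_apply R Rp K])
    (fun a => by
      change algebraMap Rp B (algebraMap R Rp (algebraMap A R a)) = _
      rw [halg, ← IsScalarTower.algebraMap_apply A R Rp, IsScalarTower.algebraMap_apply A FA Rp,
        IsScalarTower.algebraMap_apply A FA K, ← IsScalarTower.algebraMap_apply FA Rp B]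
      exact ((Algebra.TensorProduct.includeRight : K →ₐ[FA] Rp ⊗[FA] K).commutes _).symm)
    ι
    (fun r m => by
      have e1 : (1 : Rp) ⊗ₜ[R] (Submodule.Quotient.mk (r • m) : W)
          = algebraMap R Rp r • ((1 : Rp) ⊗ₜ[R] (Submodule.Quotient.mk m : W)) := by
        rw [Submodule.Quotient.mk_smul, TensorProduct.tmul_smul, algebraMap_smul]
      rw [hιdef, hιdef, e1, TensorProduct.tmul_smul]
      change _ = (algebraMap Rp B (algebraMap R Rp r)) • _
      exact (algebraMap_smul B (algebraMap R Rp r) _).symm)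
    n
  refine ⟨E, h1, h2, ?_, h4⟩
  rw [← h3]
  ext m
  constructor
  · intro hm
    have : (Submodule.Quotient.mk m : W) = 0 := (Submodule.Quotient.mk_eq_zero U).2 hm
    rw [Set.mem_ofPred_eq, hιdef, this, TensorProduct.tmul_zero, TensorProduct.tmul_zero]
    exact zero_mem _
  · intro hm
    have hm' : ι m ∈ ((RingHom.ker μ₀) ^ (n + 1) • ⊤ : Submodule B X) := hm
    have h5 := hn _ (Submodule.smul_mono_left (Ideal.pow_le_pow_right (Nat.le_succ n)) hm')
    exact (Submodule.Quotient.mk_eq_zero U).1 (hWV _ h5)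

end NoetherianOps
end
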